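/- arXiv:1307.2707 — 2 statements merged into one kernel-verified Lean document; each statement's English description precedes it below -/
import Mathlib

section
/- For every rho > rhobar_{p}: if f^rho_{p} has regularity rho, then F(p,rho) is non-empty if and only if f^rho_{p} belongs to F(p,rho); if f^rho_{p} has regularity strictly less than rho, then F(p,rho) is non-empty if and only if g^rho_{p} belongs to F(p,rho). -/
open scoped Classical

noncomputable section

/-! ## Binomial expansions and the Macaulay operations `(a_t)^+_+` and `(a_t)^-_-` -/

/-- The largest `k` such that `C(k,t) ≤ a` (top coefficient of the greedy binomial
expansion of `a` in base `t`). -/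
def expTop (a t : ℕ) : ℕ := Nat.findGreatest (fun k => Nat.choose k t ≤ a) (a + t + 1)

/-- `(a_t)^+_+` : if `a = C(k(t),t) + ... + C(k(j),j)` is the binomial expansion of `a`
in base `t`, then `plusPlus a t = C(k(t)+1,t+1) + ... + C(k(j)+1,j+1)`; it sends `0` to `0`. -/
def plusPlus : ℕ → ℕ → ℕ
  | _, 0 => 0
  | a, t + 1 =>
    if a = 0 then 0
    else Nat.choose (expTop a (t + 1) + 1) (t + 2) +
      plusPlus (a - Nat.choose (expTop a (t + 1)) (t + 1)) t

/-- `(a_t)^-_-` : if `a = C(k(t),t) + ... + C(k(j),j)` is the binomial expansion of `a`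
in base `t`, then `minusMinus a t = C(k(t)-1,t-1) + ... + C(k(j)-1,j-1)`; it sends `0` to `0`. -/
def minusMinus : ℕ → ℕ → ℕ
  | _, 0 => 0
  | a, t + 1 =>
    if a = 0 then 0
    else Nat.choose (expTop a (t + 1) - 1) t +
      minusMinus (a - Nat.choose (expTop a (t + 1)) (t + 1)) t

/-! ## Numerical functions -/

/-- A numerical function (modelled with values in `ℤ`) is *admissible* (an O-sequence) if it is
nonnegative, `H 0 = 1` and `H (t+1) ≤ (H(t)_t)^+_+` for every `t ≥ 1`. -/
def OSeq (H : ℕ → ℤ) : Prop :=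
  (∀ t, 0 ≤ H t) ∧ H 0 = 1 ∧ ∀ t, 1 ≤ t → H (t + 1) ≤ (plusPlus (H t).toNat t : ℤ)

/-- First derivative of a numerical function: `Δf(0) = 1`, `Δf(t) = f(t) - f(t-1)`. -/
def nderiv (f : ℕ → ℤ) : ℕ → ℤ
  | 0 => 1
  | t + 1 => f (t + 1) - f t

/-- Integral of a numerical function: `Σg(0) = 1`, `Σg(t) = Σg(t-1) + g(t)`. -/
def ninteg (g : ℕ → ℤ) : ℕ → ℤ
  | 0 => 1
  | t + 1 => ninteg g t + g (t + 1)

/-! ## Admissible Hilbert polynomials in Gotzmann form -/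

/-- The integer-valued binomial coefficient `C(a,k)` for `a : ℤ`, agreeing with the
polynomial binomial coefficient `a(a-1)⋯(a-k+1)/k!`. -/
def zchoose (a : ℤ) (k : ℕ) : ℤ :=
  if 0 ≤ a then (a.toNat.choose k : ℤ)
  else (-1) ^ k * (((k : ℤ) - 1 - a).toNat.choose k : ℤ)

/-- An admissible Hilbert polynomial, recorded through its Gotzmann form
`p(z) = C(z+k₁,k₁) + C(z+k₂-1,k₂) + ... + C(z+k_r-(r-1),k_r)` with `k₁ ≥ k₂ ≥ ... ≥ k_r ≥ 0`. -/
structure GotzmannPoly where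
  ks : List ℕ
  sorted : ks.Pairwise (· ≥ ·)

namespace GotzmannPoly

/-- The Gotzmann number `r` of `p`. -/
def r (p : GotzmannPoly) : ℕ := p.ks.length

/-- The degree of `p`, namely `k₁`. -/
def degree (p : GotzmannPoly) : ℕ := p.ks.headD 0

/-- Evaluation of `p` at an integer. -/
def eval (p : GotzmannPoly) (z : ℤ) : ℤ :=
  ∑ i ∈ Finset.range p.r, zchoose (z + (p.ks.getD i 0 : ℤ) - i) (p.ks.getD i 0)

/-- The first difference `Δp(z) = p(z) - p(z-1)`, in Gotzmann form. -/
def delta (p : GotzmannPoly) : GotzmannPoly where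
  ks := (p.ks.filter fun k => 1 ≤ k).map fun k => k - 1
  sorted := by
    refine List.Pairwise.map _ (fun {a b} h => Nat.sub_le_sub_right h 1) ?_
    exact p.sorted.filter _

/-- Iterated first difference `Δ^i p`. -/
def deltaIter (p : GotzmannPoly) (i : ℕ) : GotzmannPoly := delta^[i] p

/-- The polynomial `p(z) + c`, in Gotzmann form. -/
def addConst (p : GotzmannPoly) (c : ℕ) : GotzmannPoly where
  ks := p.ks ++ List.replicate c 0
  sorted := by
    rw [List.pairwise_append]
    refine ⟨p.sorted, ?_, ?_⟩
    · exact List.pairwise_replicate.2 (Or.inr le_rfl)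
    · intro a _ b hb
      rw [List.eq_of_mem_replicate hb]
      exact Nat.zero_le a

end GotzmannPoly

/-- The set `Π_p = {1 ≤ t ≤ r : (p(t+h)_{t+h})^+_+ ≥ p(t+h+1) ≥ 1 for all h ≥ 0}`. -/
def PiSet (p : GotzmannPoly) : Set ℕ :=
  {t | 1 ≤ t ∧ t ≤ p.r ∧ ∀ h : ℕ,
      p.eval ((t : ℤ) + (h : ℤ) + 1) ≤ (plusPlus (p.eval ((t : ℤ) + (h : ℤ))).toNat (t + h) : ℤ) ∧
      1 ≤ p.eval ((t : ℤ) + (h : ℤ) + 1)}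

/-- `ρ_p`: `0` if `min Π_p = 1` and `p(0) = 1`, and `min Π_p` otherwise. -/
def rhoP (p : GotzmannPoly) : ℕ :=
  if sInf (PiSet p) = 1 ∧ p.eval 0 = 1 then 0 else sInf (PiSet p)

/-- The minimal function `f^ρ_p` : `f(t) = p(t)` for `t ≥ ρ` and
`f(t) = ((f(t+1))_{t+1})^-_-` for `t < ρ`. -/
def fmin (p : GotzmannPoly) (ρ : ℕ) (t : ℕ) : ℤ :=
  if h : ρ ≤ t then p.eval (t : ℤ)
  else (minusMinus (fmin p ρ (t + 1)).toNat (t + 1) : ℤ)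
termination_by ρ - t
decreasing_by omega

/-- The function `g^ρ_p` : `g(t) = p(t)` for `t ≥ ρ`, `g(ρ-1) = p(ρ-1) + 1` and
`g(t) = ((g(t+1))_{t+1})^-_-` for `t < ρ-1`. -/
def gmin (p : GotzmannPoly) (ρ : ℕ) (t : ℕ) : ℤ :=
  if h : ρ ≤ t then p.eval (t : ℤ)
  else if t = ρ - 1 then p.eval (t : ℤ) + 1
  else (minusMinus (gmin p ρ (t + 1)).toNat (t + 1) : ℤ)
termination_by ρ - t
decreasing_by omega

/-- `H` has regularity `ρ` (with respect to the Hilbert polynomial `p`): `ρ` is the least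
integer such that `H(t) = p(t)` for all `t ≥ ρ`. -/
def IsRegOf (p : GotzmannPoly) (H : ℕ → ℤ) (ρ : ℕ) : Prop :=
  (∀ t : ℕ, ρ ≤ t → H t = p.eval (t : ℤ)) ∧
  ∀ ρ' : ℕ, (∀ t : ℕ, ρ' ≤ t → H t = p.eval (t : ℤ)) → ρ ≤ ρ'

/-- `H` has Hilbert polynomial `p`, i.e. eventually agrees with `p`. -/
def HasHP (p : GotzmannPoly) (H : ℕ → ℤ) : Prop :=
  ∃ N : ℕ, ∀ t : ℕ, N ≤ t → H t = p.eval (t : ℤ)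

/-- `F(p,ρ)`: the set of Hilbert functions of closed projective subschemes (i.e. numerical
functions which are admissible together with their first derivative) with Hilbert
polynomial `p` and regularity `ρ`. -/
def Fset (p : GotzmannPoly) (ρ : ℕ) : Set (ℕ → ℤ) :=
  {H | OSeq H ∧ OSeq (nderiv H) ∧ IsRegOf p H ρ}

/-- `ρ̄_p`: the minimal `ρ` such that `F(p,ρ)` is non-empty. -/
def rhobar (p : GotzmannPoly) : ℕ := sInf {ρ | (Fset p ρ).Nonempty}

/-! ## Monomial ideals in `K[x₀,…,xₙ]` (combinatorial model) -/

/-- Monomials of `K[x₀,…,xₙ]`, as exponent vectors. -/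
abbrev Mon (n : ℕ) := Fin (n + 1) → ℕ

/-- Degree of a monomial. -/
def mdeg {n : ℕ} (m : Mon n) : ℕ := ∑ i, m i

/-- `T_t`, the set of terms of degree `t`. -/
def Tset (n t : ℕ) : Set (Mon n) := {m | mdeg m = t}

/-- A set of monomials closed under multiplication by arbitrary monomials (a monomial ideal). -/
def MonIdeal {n : ℕ} (J : Set (Mon n)) : Prop :=
  ∀ m ∈ J, ∀ m' : Mon n, m + m' ∈ J

/-- The elementary Borel move sending `x^m` to `x_i · x^m / x_j`. -/
def borelStep {n : ℕ} (m : Mon n) (j i : Fin (n + 1)) : Mon n :=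
  fun l => if l = j then m l - 1 else if l = i then m l + 1 else m l

/-- One elementary Borel move `x_j ↦ x_i` with `j < i`. -/
def borelMove {n : ℕ} (a b : Mon n) : Prop :=
  ∃ j i : Fin (n + 1), j < i ∧ 1 ≤ a j ∧ b = borelStep a j i

/-- The Borel (partial) order `≤_B` on monomials. -/
def borelLE {n : ℕ} : Mon n → Mon n → Prop := Relation.ReflTransGen borelMove

/-- A strongly stable (Borel) monomial ideal. -/
def StronglyStable {n : ℕ} (J : Set (Mon n)) : Prop :=
  MonIdeal J ∧ ∀ m ∈ J, ∀ j i : Fin (n + 1), j < i → 1 ≤ m j → borelStep m j i ∈ J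

/-- A Borel set in `T_t`: a set of degree-`t` monomials closed upwards under `≤_B`. -/
def IsBorelSet {n : ℕ} (t : ℕ) (B : Set (Mon n)) : Prop :=
  B ⊆ Tset n t ∧ ∀ a ∈ B, ∀ b : Mon n, borelLE a b → b ∈ B

/-- Saturation of a monomial ideal:
`J^sat = {m : for every i there is k with x_i^k · m ∈ J}`. -/
def monSat {n : ℕ} (J : Set (Mon n)) : Set (Mon n) :=
  {m | ∀ i : Fin (n + 1), ∃ k : ℕ, (fun l => if l = i then m l + k else m l) ∈ J}

/-- The monomial ideal generated by a set of monomials. -/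
def genIdeal {n : ℕ} (B : Set (Mon n)) : Set (Mon n) :=
  {m | ∃ b ∈ B, ∃ c : Mon n, m = b + c}

/-- The Hilbert function of `S/J` for a monomial ideal `J`: the number of degree-`t`
monomials outside `J`. -/
def hilb {n : ℕ} (J : Set (Mon n)) (t : ℕ) : ℕ :=
  Set.ncard {m : Mon n | mdeg m = t ∧ m ∉ J}

/-- `m / x_i` as an exponent vector. -/
def shrinkAt {n : ℕ} (m : Mon n) (i : Fin (n + 1)) : Mon n :=
  fun l => if l = i then m l - 1 else m l

/-- `m` is a minimal (monomial) generator of the monomial ideal `J`. -/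
def IsMinGen {n : ℕ} (J : Set (Mon n)) (m : Mon n) : Prop :=
  m ∈ J ∧ ∀ i : Fin (n + 1), 1 ≤ m i → shrinkAt m i ∉ J

/-- The Castelnuovo–Mumford regularity of a strongly stable ideal: the maximal degree of a
minimal monomial generator. -/
def monReg {n : ℕ} (J : Set (Mon n)) : ℕ :=
  sSup {d | ∃ m : Mon n, IsMinGen J m ∧ mdeg m = d}

/-- `m_u`: the minimal Castelnuovo–Mumford regularity of a closed projective subscheme with
Hilbert function `u`, i.e. the minimum of `reg J` over all `n` and all saturated strongly
stable ideals `J ⊆ K[x₀,…,xₙ]` with `H_{S/J} = u`. -/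
def mReg (u : ℕ → ℤ) : ℕ :=
  sInf {r | ∃ (n : ℕ) (J : Set (Mon n)), StronglyStable J ∧ monSat J = J ∧
      (∀ t : ℕ, (hilb J t : ℤ) = u t) ∧ monReg J = r}

/-- `M(p,ρ) = {m_u : u ∈ F(p,ρ)}`. -/
def Mset (p : GotzmannPoly) (ρ : ℕ) : Set ℕ := {r | ∃ u ∈ Fset p ρ, mReg u = r}

/-- `m^ρ_p = min M(p,ρ)`. -/
def mRho (p : GotzmannPoly) (ρ : ℕ) : ℕ := sInf (Mset p ρ)

/-- `m_p`: the minimal Castelnuovo–Mumford regularity of schemes with Hilbert polynomial `p`. -/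
def mP (p : GotzmannPoly) : ℕ := sInf {r | ∃ ρ : ℕ, ∃ u ∈ Fset p ρ, mReg u = r}

/-! ## Lex segments and growth-height-lexicographic Borel sets -/

/-- `a` is smaller than `b` in the deglex order (for monomials of the same degree):
`a k < b k` where `k` is the largest index where they differ. -/
def deglexLT {n : ℕ} (a b : Mon n) : Prop :=
  ∃ k : Fin (n + 1), a k < b k ∧ ∀ l : Fin (n + 1), k < l → a l = b l

/-- A lex-segment of `T_t`: a set of degree-`t` monomials consisting of the highest terms
with respect to deglex. -/
def IsLexSeg {n : ℕ} (t : ℕ) (L : Set (Mon n)) : Prop :=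
  L ⊆ Tset n t ∧ ∀ a ∈ L, ∀ b ∈ Tset n t, deglexLT a b → b ∈ L

/-- A lex-segment in `A ⊆ T_t`: the intersection of a lex-segment of `T_t` with `A`. -/
def LexSegIn {n : ℕ} (t : ℕ) (A S : Set (Mon n)) : Prop :=
  ∃ L : Set (Mon n), IsLexSeg t L ∧ S = L ∩ A

/-- The growth class `B^{(i)} = {m ∈ B : min(m) = i}`. -/
def growthClass {n : ℕ} (B : Set (Mon n)) (i : Fin (n + 1)) : Set (Mon n) :=
  {m | m ∈ B ∧ 1 ≤ m i ∧ ∀ j : Fin (n + 1), j < i → m j = 0}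

/-- The height class `B(i) = {m ∈ B : the exponent of x₀ in m is i}`. -/
def heightClass {n : ℕ} (B : Set (Mon n)) (i : ℕ) : Set (Mon n) :=
  {m | m ∈ B ∧ m 0 = i}

/-- A Borel set `B ⊆ T_t` is growth-lexicographic if all its growth classes are lex-segments
in the corresponding growth classes of `T_t`. -/
def GrowthLex {n : ℕ} (t : ℕ) (B : Set (Mon n)) : Prop :=
  ∀ i : Fin (n + 1), LexSegIn t (growthClass (Tset n t) i) (growthClass B i)

/-- A Borel set `B ⊆ T_t` is growth-height-lexicographic if `B(0)` is growth-lexicographic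
and `B(i)` is a lex-segment in `T_t(i)` for every `0 < i ≤ t`. -/
def GHLex {n : ℕ} (t : ℕ) (B : Set (Mon n)) : Prop :=
  GrowthLex t (heightClass B 0) ∧
  ∀ i : ℕ, 0 < i → i ≤ t → LexSegIn t (heightClass (Tset n t) i) (heightClass B i)

end

/-! ## Arithmetic of the Macaulay operations -/

theorem sub_lt_choose_succ {n t : ℕ} (h : t + 1 ≤ n) : n - t ≤ n.choose (t + 1) := by
  obtain ⟨d, rfl⟩ := Nat.exists_eq_add_of_le h
  induction d with
  | zero => simp
  | succ d ih =>
    have h1 : (t + 1 + (d + 1)).choose (t + 1) =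
        (t + 1 + d).choose t + (t + 1 + d).choose (t + 1) := Nat.choose_succ_succ _ _
    have h2 : 0 < (t + 1 + d).choose t := Nat.choose_pos (by omega)
    have h3 := ih (by omega)
    omega

theorem expTop_eq {a t m : ℕ} (hm : t ≤ m) (h1 : (m + 1).choose (t + 1) ≤ a)
    (h2 : a < (m + 2).choose (t + 1)) : expTop a (t + 1) = m + 1 := by
  unfold expTop
  rw [Nat.findGreatest_eq_iff]
  refine ⟨?_, fun _ => h1, ?_⟩
  · have := sub_lt_choose_succ (show t + 1 ≤ m + 1 by omega)
    omega
  · intro n hn _ h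
    have := Nat.choose_le_choose (t + 1) (show m + 2 ≤ n by omega)
    omega

theorem exists_eq_choose_add (t : ℕ) {a : ℕ} (ha : 1 ≤ a) :
    ∃ m b, t ≤ m ∧ b < (m + 1).choose t ∧ a = (m + 1).choose (t + 1) + b := by
  have hex : ∃ m, a < (m + 2).choose (t + 1) := by
    refine ⟨a + t, ?_⟩
    have := sub_lt_choose_succ (show t + 1 ≤ a + t + 2 by omega)
    omega
  have h1 : (Nat.find hex + 1).choose (t + 1) ≤ a := by
    rcases Nat.eq_zero_or_pos (Nat.find hex) with h0 | h0
    · rw [h0]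
      exact (Nat.choose_le_choose (t + 1) (by omega : 0 + 1 ≤ t + 1)).trans (by simpa using ha)
    · have := Nat.find_min hex (show Nat.find hex - 1 < Nat.find hex by omega)
      rw [show Nat.find hex - 1 + 2 = Nat.find hex + 1 by omega] at this
      omega
  have h2 := Nat.find_spec hex
  have h3 : (Nat.find hex + 2).choose (t + 1) =
      (Nat.find hex + 1).choose t + (Nat.find hex + 1).choose (t + 1) :=
    Nat.choose_succ_succ _ _
  refine ⟨Nat.find hex, a - (Nat.find hex + 1).choose (t + 1), ?_, by omega, by omega⟩
  by_contra! h
  have := Nat.choose_le_choose (t + 1) (show Nat.find hex + 2 ≤ t + 1 by omega)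
  rw [Nat.choose_self] at this
  omega

@[simp] theorem minusMinus_zero_left (t : ℕ) : minusMinus 0 t = 0 := by
  cases t <;> simp [minusMinus]

@[simp] theorem plusPlus_zero_left (t : ℕ) : plusPlus 0 t = 0 := by
  cases t <;> simp [plusPlus]

theorem minusMinus_choose_add_of_lt {t m b : ℕ} (hm : t ≤ m) (hb : b < (m + 1).choose t) :
    minusMinus ((m + 1).choose (t + 1) + b) (t + 1) = m.choose t + minusMinus b t := by
  have h3 : (m + 2).choose (t + 1) = (m + 1).choose t + (m + 1).choose (t + 1) :=
    Nat.choose_succ_succ _ _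
  have hpos : 0 < (m + 1).choose (t + 1) := Nat.choose_pos (by omega)
  have he : expTop ((m + 1).choose (t + 1) + b) (t + 1) = m + 1 :=
    expTop_eq hm (by omega) (by omega)
  rw [minusMinus, if_neg (by omega), he]
  simp

theorem plusPlus_choose_add_of_lt {t m b : ℕ} (hm : t ≤ m) (hb : b < (m + 1).choose t) :
    plusPlus ((m + 1).choose (t + 1) + b) (t + 1) = (m + 2).choose (t + 2) + plusPlus b t := by
  have h3 : (m + 2).choose (t + 1) = (m + 1).choose t + (m + 1).choose (t + 1) :=
    Nat.choose_succ_succ _ _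
  have hpos : 0 < (m + 1).choose (t + 1) := Nat.choose_pos (by omega)
  have he : expTop ((m + 1).choose (t + 1) + b) (t + 1) = m + 1 :=
    expTop_eq hm (by omega) (by omega)
  rw [plusPlus, if_neg (by omega), he]
  simp

theorem minusMinus_choose {t m : ℕ} (hm : t ≤ m) :
    minusMinus ((m + 1).choose (t + 1)) (t + 1) = m.choose t := by
  simpa using minusMinus_choose_add_of_lt (b := 0) hm (Nat.choose_pos (by omega))

theorem plusPlus_choose {t m : ℕ} (hm : t ≤ m) :
    plusPlus ((m + 1).choose (t + 1)) (t + 1) = (m + 2).choose (t + 2) := by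
  simpa using plusPlus_choose_add_of_lt (b := 0) hm (Nat.choose_pos (by omega))

theorem minusMinus_choose_add {t m b : ℕ} (hm : t ≤ m) (hb : b ≤ (m + 1).choose t) :
    minusMinus ((m + 1).choose (t + 1) + b) (t + 1) = m.choose t + minusMinus b t := by
  rcases hb.lt_or_eq with h | rfl
  · exact minusMinus_choose_add_of_lt hm h
  have h3 : (m + 2).choose (t + 1) = (m + 1).choose t + (m + 1).choose (t + 1) :=
    Nat.choose_succ_succ _ _
  rw [add_comm, ← h3, minusMinus_choose (by omega : t ≤ m + 1)]
  cases t with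
  | zero => simp [minusMinus]
  | succ t =>
    rw [minusMinus_choose (by omega : t ≤ m), Nat.choose_succ_succ, add_comm]

theorem plusPlus_choose_add {t m b : ℕ} (hm : t + 1 ≤ m) (hb : b ≤ (m + 1).choose (t + 1)) :
    plusPlus ((m + 1).choose (t + 2) + b) (t + 2) =
      (m + 2).choose (t + 3) + plusPlus b (t + 1) := by
  rcases hb.lt_or_eq with h | rfl
  · exact plusPlus_choose_add_of_lt hm h
  have h3 : (m + 2).choose (t + 2) = (m + 1).choose (t + 1) + (m + 1).choose (t + 2) :=
    Nat.choose_succ_succ _ _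
  rw [add_comm, ← h3, plusPlus_choose (by omega : t + 1 ≤ m + 1),
    plusPlus_choose (by omega : t ≤ m), Nat.choose_succ_succ, add_comm]

theorem minusMinus_one_right {a : ℕ} (ha : 1 ≤ a) : minusMinus a 1 = 1 := by
  have := minusMinus_choose (t := 0) (m := a - 1) (by omega)
  simpa [Nat.sub_add_cancel ha] using this

theorem plusPlus_one_right (a : ℕ) : plusPlus a 1 = (a + 1).choose 2 := by
  rcases Nat.eq_zero_or_pos a with rfl | ha
  · simp
  have := plusPlus_choose (t := 0) (m := a - 1) (by omega)
  simpa [show a - 1 + 1 = a by omega, show a - 1 + 2 = a + 1 by omega] using this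

theorem minusMinus_pos (t : ℕ) {a : ℕ} (ha : 1 ≤ a) : 1 ≤ minusMinus a (t + 1) := by
  obtain ⟨m, b, hm, hb, rfl⟩ := exists_eq_choose_add t ha
  rw [minusMinus_choose_add hm hb.le]
  have : 0 < m.choose t := Nat.choose_pos hm
  omega

theorem minusMinus_succ (a t : ℕ) :
    minusMinus a t ≤ minusMinus (a + 1) t ∧ minusMinus (a + 1) t ≤ minusMinus a t + 1 := by
  induction t generalizing a with
  | zero => simp [minusMinus]
  | succ t ih =>
    rcases Nat.eq_zero_or_pos a with rfl | ha
    · have := minusMinus_choose (le_refl t)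
      simp only [Nat.choose_self] at this
      simp [this]
    · obtain ⟨m, b, hm, hb, rfl⟩ := exists_eq_choose_add t ha
      rw [add_assoc, minusMinus_choose_add hm hb.le, minusMinus_choose_add (b := b + 1) hm hb]
      have := ih b
      omega

theorem minusMinus_mono (t : ℕ) : Monotone fun a => minusMinus a t :=
  monotone_nat_of_le_succ fun a => (minusMinus_succ a t).1

theorem minusMinus_le (a t : ℕ) : minusMinus a t ≤ a := by
  induction a with
  | zero => simp
  | succ a ih => exact (minusMinus_succ a t).2.trans (by omega)

theorem sub_minusMinus_mono (t : ℕ) : Monotone fun n => n - minusMinus n t :=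
  monotone_nat_of_le_succ fun n => by
    have := minusMinus_succ n t
    have := minusMinus_le n t
    show n - minusMinus n t ≤ n + 1 - minusMinus (n + 1) t
    omega

theorem plusPlus_mono (t : ℕ) : Monotone fun a => plusPlus a t := by
  refine monotone_nat_of_le_succ fun a => ?_
  induction t generalizing a with
  | zero => simp [plusPlus]
  | succ t ih =>
    rcases Nat.eq_zero_or_pos a with rfl | ha
    · simp
    cases t with
    | zero =>
      simp only [zero_add, plusPlus_one_right]
      exact Nat.choose_le_choose _ (by omega)
    | succ t =>
      obtain ⟨m, b, hm, hb, rfl⟩ := exists_eq_choose_add (t + 1) ha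
      rw [add_assoc _ b 1, plusPlus_choose_add hm hb.le, plusPlus_choose_add (b := b + 1) hm hb]
      have := ih b
      omega

theorem minusMinus_plusPlus (a t : ℕ) :
    minusMinus (plusPlus a (t + 1)) (t + 2) = a := by
  induction t generalizing a with
  | zero =>
    rcases Nat.eq_zero_or_pos a with rfl | ha
    · simp
    rw [plusPlus_one_right, minusMinus_choose ha, Nat.choose_one_right]
  | succ t ih =>
    rcases Nat.eq_zero_or_pos a with rfl | ha
    · simp
    obtain ⟨m, b, hm, hb, rfl⟩ := exists_eq_choose_add (t + 1) ha
    have h1 : plusPlus b (t + 1) ≤ plusPlus ((m + 1).choose (t + 1)) (t + 1) :=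
      plusPlus_mono (t + 1) hb.le
    rw [plusPlus_choose (by omega)] at h1
    rw [plusPlus_choose_add hm hb.le, minusMinus_choose_add (by omega) h1, ih]

theorem le_plusPlus_minusMinus (a t : ℕ) :
    a ≤ plusPlus (minusMinus a (t + 2)) (t + 1) := by
  induction t generalizing a with
  | zero =>
    rcases Nat.eq_zero_or_pos a with rfl | ha
    · simp
    obtain ⟨m, b, hm, hb, rfl⟩ := exists_eq_choose_add 1 ha
    rw [minusMinus_choose_add hm hb.le, plusPlus_one_right, Nat.choose_one_right]
    rcases Nat.eq_zero_or_pos b with rfl | hb0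
    · simp
    · rw [minusMinus_one_right hb0]
      have h3 : (m + 1 + 1).choose 2 = (m + 1).choose 1 + (m + 1).choose 2 :=
        Nat.choose_succ_succ _ _
      simp only [Nat.reduceAdd, Nat.choose_one_right] at *
      omega
  | succ t ih =>
    rcases Nat.eq_zero_or_pos a with rfl | ha
    · simp
    obtain ⟨m, b, hm, hb, rfl⟩ := exists_eq_choose_add (t + 2) ha
    have h1 : minusMinus b (t + 2) ≤ minusMinus ((m + 1).choose (t + 2)) (t + 2) :=
      minusMinus_mono (t + 2) hb.le
    rw [minusMinus_choose (by omega)] at h1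
    obtain ⟨m, rfl⟩ := Nat.exists_eq_add_of_le' (show 1 ≤ m by omega)
    rw [minusMinus_choose_add hm hb.le, plusPlus_choose_add (by omega) h1]
    have := ih b
    simp only [Nat.add_assoc, Nat.reduceAdd] at *
    omega

theorem minusMinus_eq_self {b t : ℕ} (h : b ≤ t) : minusMinus b t = b := by
  induction t generalizing b with
  | zero => simp [show b = 0 by omega]
  | succ t ih =>
    rcases Nat.eq_zero_or_pos b with rfl | hb
    · simp
    obtain ⟨c, rfl⟩ := Nat.exists_eq_add_of_le hb
    have := minusMinus_choose_add (b := c) (le_refl t) (by rw [Nat.choose_succ_self_right]; omega)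
    rw [Nat.choose_self, Nat.choose_self, ih (by omega)] at this
    exact this

/-- Growth bound for the differences `a - (a_t)^-_-` along successive applications
of `(·)^-_-`. -/
theorem sub_minusMinus_le_plusPlus (a t : ℕ) :
    a - minusMinus a (t + 2) ≤
      plusPlus (minusMinus a (t + 2) - minusMinus (minusMinus a (t + 2)) (t + 1)) (t + 1) := by
  induction t generalizing a with
  | zero =>
    rcases Nat.eq_zero_or_pos a with rfl | ha
    · simp
    obtain ⟨m, b, hm, hb, rfl⟩ := exists_eq_choose_add 1 ha
    have h3 : (m + 1).choose 2 = m.choose 1 + m.choose 2 := Nat.choose_succ_succ _ _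
    rw [minusMinus_choose_add hm hb.le, minusMinus_one_right (a := _ + _)
      (by rw [Nat.choose_one_right]; omega), plusPlus_one_right]
    simp only [Nat.choose_one_right, Nat.reduceAdd] at *
    rcases Nat.eq_zero_or_pos b with rfl | hb0
    · rw [minusMinus_zero_left, show m + 0 - 1 + 1 = m by omega, h3]
      omega
    · rw [minusMinus_one_right hb0, show m + 1 - 1 + 1 = m + 1 by omega]
      omega
  | succ t ih =>
    rcases Nat.eq_zero_or_pos a with rfl | ha
    · simp
    obtain ⟨m, b, hm, hb, rfl⟩ := exists_eq_choose_add (t + 2) ha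
    rcases hm.lt_or_eq with hm' | rfl
    · obtain ⟨m, rfl⟩ := Nat.exists_eq_add_of_le' (show 2 ≤ m by omega)
      have h1 : minusMinus b (t + 2) ≤ (m + 2).choose (t + 1) := by
        have : minusMinus b (t + 2) ≤ minusMinus ((m + 2 + 1).choose (t + 2)) (t + 2) :=
          minusMinus_mono (t + 2) hb.le
        rwa [minusMinus_choose (by omega)] at this
      rw [minusMinus_choose_add hm hb.le, minusMinus_choose_add (by omega : t + 1 ≤ m + 1) h1]
      set c := minusMinus b (t + 2)
      have h4 : (m + 1 + 1).choose (t + 2) = (m + 1).choose (t + 1) + (m + 1).choose (t + 2) :=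
        Nat.choose_succ_succ _ _
      have h5 : (m + 2 + 1).choose (t + 3) = (m + 2).choose (t + 2) + (m + 2).choose (t + 3) :=
        Nat.choose_succ_succ _ _
      have h6 : (m + 2).choose (t + 1) = (m + 1).choose t + (m + 1).choose (t + 1) :=
        Nat.choose_succ_succ _ _
      have h7 : c ≤ b := minusMinus_le _ _
      have h8 : minusMinus c (t + 1) ≤ c := minusMinus_le _ _
      have h9 : c - minusMinus c (t + 1) ≤ (m + 1).choose (t + 1) := by
        have := sub_minusMinus_mono (t + 1) h1
        simp only at this
        rw [minusMinus_choose (by omega)] at this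
        omega
      rw [show (m + 2).choose (t + 2) + c - ((m + 1).choose (t + 1) + minusMinus c (t + 1)) =
        (m + 1).choose (t + 2) + (c - minusMinus c (t + 1)) by
          simp only [Nat.add_assoc, Nat.reduceAdd] at *
          omega,
        plusPlus_choose_add (by omega) h9]
      have h10 : b - c ≤ plusPlus (c - minusMinus c (t + 1)) (t + 1) := ih b
      simp only [Nat.add_assoc, Nat.reduceAdd] at *
      omega
    · have h2 : b ≤ t + 2 := by
        rw [Nat.choose_succ_self_right] at hb
        omega
      rw [Nat.choose_self, minusMinus_eq_self (by omega)]
      simp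

/-! ## Minimal functions -/

theorem OSeq.minusMinus_le {H : ℕ → ℤ} (hH : OSeq H) {t : ℕ} (ht : 1 ≤ t) :
    (minusMinus (H (t + 1)).toNat (t + 1) : ℤ) ≤ H t := by
  obtain ⟨t, rfl⟩ := Nat.exists_eq_add_of_le' ht
  have h1 : (H (t + 1 + 1)).toNat ≤ plusPlus (H (t + 1)).toNat (t + 1) := by
    have := hH.2.2 (t + 1) ht
    omega
  have h2 : minusMinus (H (t + 1 + 1)).toNat (t + 2) ≤
      minusMinus (plusPlus (H (t + 1)).toNat (t + 1)) (t + 2) := minusMinus_mono (t + 2) h1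
  rw [minusMinus_plusPlus] at h2
  have := hH.1 (t + 1)
  show (minusMinus (H (t + 1 + 1)).toNat (t + 2) : ℤ) ≤ _
  omega

theorem pos_and_le_of_minusMinus {F H : ℕ → ℤ} (hH : OSeq H) {s : ℕ}
    (hF : ∀ t < s, F t = (minusMinus (F (t + 1)).toNat (t + 1) : ℤ))
    (hpos : 1 ≤ F s) (hle : F s ≤ H s) (t : ℕ) (ht : t ≤ s) : 1 ≤ F t ∧ F t ≤ H t := by
  induction ht using Nat.decreasingInduction with
  | self => exact ⟨hpos, hle⟩
  | of_succ t ht ih =>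
    rw [hF t ht]
    have h1 := minusMinus_pos t (show 1 ≤ (F (t + 1)).toNat by omega)
    refine ⟨by exact_mod_cast h1, ?_⟩
    rcases Nat.eq_zero_or_pos t with rfl | ht0
    · rw [minusMinus_one_right (by omega), hH.2.1]
      rfl
    · refine le_trans ?_ (hH.minusMinus_le ht0)
      exact_mod_cast minusMinus_mono (t + 1) (Int.toNat_le_toNat ih.2)

theorem plusPlus_toNat_mono (t : ℕ) {a b : ℤ} (h : a ≤ b) :
    (plusPlus a.toNat t : ℤ) ≤ plusPlus b.toNat t := by
  exact_mod_cast plusPlus_mono t (Int.toNat_le_toNat h)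

/-- Difference growth of a function that is obtained by applying `(·)^-_-` twice. -/
theorem sub_le_plusPlus_of_minusMinus {F : ℕ → ℤ} {t : ℕ} (h0 : 0 ≤ F (t + 2))
    (h1 : F (t + 1) = (minusMinus (F (t + 2)).toNat (t + 2) : ℤ))
    (h2 : F t = (minusMinus (F (t + 1)).toNat (t + 1) : ℤ)) :
    F (t + 2) - F (t + 1) ≤ (plusPlus (F (t + 1) - F t).toNat (t + 1) : ℤ) := by
  have key := sub_minusMinus_le_plusPlus (F (t + 2)).toNat t
  have h3 := minusMinus_le (F (t + 2)).toNat (t + 2)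
  rw [show (F (t + 1) - F t).toNat = minusMinus (F (t + 2)).toNat (t + 2) -
    minusMinus (minusMinus (F (t + 2)).toNat (t + 2)) (t + 1) by
      rw [h2, h1, Int.toNat_natCast, ← Nat.cast_sub (minusMinus_le _ _), Int.toNat_natCast]]
  omega

/-- A function that agrees with an admissible differentiable `H` above `s` and is minimal below
`s` is admissible together with its derivative once this holds around `s`. -/
theorem oSeq_of_minusMinus {F H : ℕ → ℤ} (hH : OSeq H) (hH' : OSeq (nderiv H)) {s : ℕ}
    (hs : 1 ≤ s) (hF : ∀ t < s, F t = (minusMinus (F (t + 1)).toNat (t + 1) : ℤ))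
    (hFH : ∀ t, s < t → F t = H t) (hpos : 1 ≤ F s) (hle : F s ≤ H s)
    (hgrow : F (s + 1) ≤ (plusPlus (F s).toNat s : ℤ))
    (hgrow' : F (s + 1) - F s ≤ (plusPlus (F s - F (s - 1)).toNat s : ℤ)) :
    OSeq F ∧ OSeq (nderiv F) := by
  have hlow := pos_and_le_of_minusMinus hH hF hpos hle
  refine ⟨⟨fun t => ?_, ?_, fun t ht => ?_⟩, ⟨fun t => ?_, rfl, fun t ht => ?_⟩⟩
  · rcases le_or_gt t s with h | h
    · have := (hlow t h).1
      omega
    · rw [hFH t h]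
      exact hH.1 t
  · rw [hF 0 hs, minusMinus_one_right]
    · rfl
    · have := (hlow (0 + 1) hs).1
      omega
  · rcases lt_trichotomy t s with h | rfl | h
    · obtain ⟨t, rfl⟩ := Nat.exists_eq_add_of_le' ht
      have := le_plusPlus_minusMinus (F (t + 1 + 1)).toNat t
      rw [hF _ h, Int.toNat_natCast]
      simp only [Nat.add_assoc, Nat.reduceAdd] at *
      omega
    · exact hgrow
    · rw [hFH _ h, hFH _ (h.trans (Nat.lt_add_one t))]
      exact hH.2.2 t ht
  · cases t with
    | zero => exact zero_le_one
    | succ t =>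
      show 0 ≤ F (t + 1) - F t
      have hd : 0 ≤ H (t + 1) - H t := hH'.1 (t + 1)
      rcases lt_trichotomy t s with h | rfl | h
      · have h1 := minusMinus_le (F (t + 1)).toNat (t + 1)
        have h2 := (hlow (t + 1) h).1
        have h3 := hF t h
        omega
      · rw [hFH _ (Nat.lt_add_one t)]
        omega
      · rwa [hFH _ h, hFH _ (h.trans (Nat.lt_add_one t))]
  · obtain ⟨t, rfl⟩ := Nat.exists_eq_add_of_le' ht
    show F (t + 2) - F (t + 1) ≤ (plusPlus (F (t + 1) - F t).toNat (t + 1) : ℤ)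
    have hd : H (t + 2) - H (t + 1) ≤ (plusPlus (H (t + 1) - H t).toNat (t + 1) : ℤ) :=
      hH'.2.2 (t + 1) ht
    rcases lt_trichotomy (t + 1) s with h | rfl | h
    · exact sub_le_plusPlus_of_minusMinus (zero_le_one.trans (hlow (t + 2) h).1) (hF _ h)
        (hF t (by omega))
    · exact hgrow'
    · rw [hFH _ h, hFH _ (h.trans (Nat.lt_add_one _))]
      refine hd.trans (plusPlus_toNat_mono _ (sub_le_sub_left ?_ _))
      rcases (Nat.lt_succ_iff.1 h).lt_or_eq with h' | rfl
      · exact (hFH t h').le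
      · exact hle

theorem fmin_of_le (p : GotzmannPoly) {ρ t : ℕ} (h : ρ ≤ t) : fmin p ρ t = p.eval t := by
  rw [fmin, dif_pos h]

theorem fmin_of_lt (p : GotzmannPoly) {ρ t : ℕ} (h : t < ρ) :
    fmin p ρ t = (minusMinus (fmin p ρ (t + 1)).toNat (t + 1) : ℤ) := by
  rw [fmin, dif_neg (by omega)]

theorem gmin_of_le (p : GotzmannPoly) {ρ t : ℕ} (h : ρ ≤ t) : gmin p ρ t = p.eval t := by
  rw [gmin, dif_pos h]

theorem gmin_self (p : GotzmannPoly) (s : ℕ) : gmin p (s + 1) s = p.eval s + 1 := by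
  rw [gmin, dif_neg (by omega), if_pos (by omega)]

theorem gmin_of_lt (p : GotzmannPoly) {s t : ℕ} (h : t < s) :
    gmin p (s + 1) t = (minusMinus (gmin p (s + 1) (t + 1)).toNat (t + 1) : ℤ) := by
  rw [gmin, dif_neg (by omega), if_neg (by omega)]

theorem GotzmannPoly.r_le_eval (p : GotzmannPoly) {z : ℕ} (hz : p.r ≤ z) :
    (p.r : ℤ) ≤ p.eval z := by
  have h : ∀ i ∈ Finset.range p.r,
      (1 : ℤ) ≤ zchoose (z + (p.ks.getD i 0 : ℤ) - i) (p.ks.getD i 0) := by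
    intro i hi
    have hi' := Finset.mem_range.1 hi
    rw [zchoose, if_pos (by omega)]
    have := Nat.choose_pos (n := ((z : ℤ) + (p.ks.getD i 0 : ℤ) - i).toNat)
      (k := p.ks.getD i 0) (by omega)
    exact_mod_cast this
  have := Finset.card_nsmul_le_sum _ _ _ h
  simpa [GotzmannPoly.eval] using this

theorem pos_of_mem_Fset {p : GotzmannPoly} (hr : 1 < p.r) {ρ : ℕ} (hρ : 1 ≤ ρ) {H : ℕ → ℤ}
    (hH : H ∈ Fset p ρ) : 1 ≤ H ρ := by
  by_contra! hlt
  have hzero : ∀ n, H (ρ + n) = 0 := by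
    intro n
    induction n with
    | zero => exact le_antisymm (by simpa using Int.lt_add_one_iff.1 hlt) (hH.1.1 ρ)
    | succ n ih =>
      have h1 := hH.1.2.2 (ρ + n) (by omega)
      rw [ih] at h1
      exact le_antisymm (by simpa [add_assoc] using h1) (hH.1.1 _)
  have h1 := hzero p.r
  rw [hH.2.2.1 _ (by omega)] at h1
  have := p.r_le_eval (show p.r ≤ ρ + p.r by omega)
  omega

/-- The properties shared by all minimal functions below a member of `F(p,ρ)`. -/
theorem fmin_oSeq {p : GotzmannPoly} (hr : 1 < p.r) {ρ : ℕ} (hρ : 1 ≤ ρ) {H : ℕ → ℤ}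
    (hH : H ∈ Fset p ρ) :
    (∀ t ≤ ρ, 1 ≤ fmin p ρ t ∧ fmin p ρ t ≤ H t) ∧ OSeq (fmin p ρ) ∧ OSeq (nderiv (fmin p ρ)) := by
  have hpos := pos_of_mem_Fset hr hρ hH
  have heq : ∀ t, ρ ≤ t → fmin p ρ t = H t := fun t ht => by
    rw [fmin_of_le p ht, hH.2.2.1 t ht]
  have hF : ∀ t < ρ, _ := fun t ht => fmin_of_lt p ht
  have hlow := pos_and_le_of_minusMinus hH.1 hF (by rwa [heq ρ le_rfl]) (heq ρ le_rfl).le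
  refine ⟨hlow, oSeq_of_minusMinus hH.1 hH.2.1 hρ hF (fun t ht => heq t ht.le) (hlow ρ le_rfl).1
    (hlow ρ le_rfl).2 ?_ ?_⟩
  · rw [heq _ le_rfl, heq _ (Nat.le_succ ρ)]
    exact hH.1.2.2 ρ hρ
  · rw [heq _ le_rfl, heq _ (Nat.le_succ ρ)]
    obtain ⟨s, rfl⟩ := Nat.exists_eq_add_of_le' hρ
    exact (hH.2.1.2.2 (s + 1) hρ).trans
      (plusPlus_toNat_mono _ (sub_le_sub_left (hlow s (Nat.le_succ s)).2 _))

theorem gmin_mem_Fset {p : GotzmannPoly} (hr : 1 < p.r) {s : ℕ} {H : ℕ → ℤ}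
    (hH : H ∈ Fset p (s + 1)) (hf : fmin p (s + 1) s = p.eval s) :
    gmin p (s + 1) ∈ Fset p (s + 1) := by
  obtain ⟨hlow, hf1, hf2⟩ := fmin_oSeq hr (Nat.le_add_left 1 s) hH
  have heqf : ∀ t, s < t → gmin p (s + 1) t = fmin p (s + 1) t := fun t ht => by
    rw [fmin_of_le p ht, gmin_of_le p ht]
  have heq : ∀ t, s < t → gmin p (s + 1) t = H t := fun t ht => by
    rw [gmin_of_le p ht, hH.2.2.1 t ht]
  have hgs : gmin p (s + 1) s = fmin p (s + 1) s + 1 := by rw [gmin_self, hf]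
  have hne : H s ≠ p.eval s := by
    intro h
    have := hH.2.2.2 s fun t ht => by
      rcases ht.lt_or_eq with h' | rfl
      · exact hH.2.2.1 t h'
      · exact h
    omega
  have hls := hlow s (Nat.le_succ s)
  have hgH : gmin p (s + 1) s ≤ H s := by omega
  have hs : 1 ≤ s := by
    by_contra! h
    obtain rfl : s = 0 := by omega
    have := hH.1.2.1
    omega
  have hG : ∀ t < s, _ := fun t ht => gmin_of_lt p ht
  have key := oSeq_of_minusMinus hH.1 hH.2.1 hs hG heq (by omega) hgH ?_ ?_
  · refine ⟨key.1, key.2, fun t ht => gmin_of_le p ht, fun ρ' h => ?_⟩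
    by_contra! hlt
    have := h s (by omega)
    omega
  · rw [heqf _ (Nat.lt_add_one s), hgs]
    exact (hf1.2.2 s hs).trans (plusPlus_toNat_mono _ (by omega))
  · rw [heqf _ (Nat.lt_add_one s), hgs]
    obtain ⟨u, rfl⟩ := Nat.exists_eq_add_of_le' hs
    have h1 : fmin p (u + 1 + 1) (u + 1 + 1) - fmin p (u + 1 + 1) (u + 1) ≤
        (plusPlus (fmin p (u + 1 + 1) (u + 1) - fmin p (u + 1 + 1) u).toNat (u + 1) : ℤ) :=
      hf2.2.2 (u + 1) hs
    have h2 := hG u (Nat.lt_add_one u)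
    have h3 := fmin_of_lt p (show u < u + 1 + 1 by omega)
    have h4 := (minusMinus_succ (fmin p (u + 1 + 1) (u + 1)).toNat (u + 1)).2
    rw [hgs, show (fmin p (u + 1 + 1) (u + 1) + 1).toNat =
      (fmin p (u + 1 + 1) (u + 1)).toNat + 1 by omega] at h2
    refine le_trans (by omega) (h1.trans (plusPlus_toNat_mono _ ?_))
    rw [Nat.add_sub_cancel]
    omega

/-- Theorem `th:first derivative` (ii).
For every `ρ > ρ̄_p`: if `f^ρ_p` has regularity `ρ`, then `F(p,ρ) ≠ ∅ ↔ f^ρ_p ∈ F(p,ρ)`;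
if `f^ρ_p` has regularity strictly less than `ρ`, then `F(p,ρ) ≠ ∅ ↔ g^ρ_p ∈ F(p,ρ)`. -/
theorem statement8 (p : GotzmannPoly) (hr : 1 < p.r) (ρ : ℕ) (hρ : rhobar p < ρ) :
    (IsRegOf p (fmin p ρ) ρ → ((Fset p ρ).Nonempty ↔ fmin p ρ ∈ Fset p ρ)) ∧
    ((∃ ρ' : ℕ, ρ' < ρ ∧ IsRegOf p (fmin p ρ) ρ') →
      ((Fset p ρ).Nonempty ↔ gmin p ρ ∈ Fset p ρ)) := by
  refine ⟨fun hreg => ⟨?_, fun h => ⟨_, h⟩⟩, fun hreg => ⟨?_, fun h => ⟨_, h⟩⟩⟩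
  · rintro ⟨H, hH⟩
    obtain ⟨-, h1, h2⟩ := fmin_oSeq hr (by omega : 1 ≤ ρ) hH
    exact ⟨h1, h2, hreg⟩
  · rintro ⟨H, hH⟩
    obtain ⟨ρ', hlt, hρ'⟩ := hreg
    obtain ⟨s, rfl⟩ := Nat.exists_eq_add_of_le' (by omega : 1 ≤ ρ)
    exact gmin_mem_Fset hr hH (hρ'.1 s (by omega))
end

section
/- Let B be a Borel set in T_t. Then there exists a unique growth-height-lexicographic Borel set L_gh(B) in T_t with gv(L_gh(B)) = gv(B) and hv(L_gh(B)) = hv(B). Moreover, the ideals J := ((B))^sat and I := ((L_gh(B)))^sat (the saturations of the ideals generated by B and by L_gh(B)) have the same Hilbert function, and reg(J) <= reg(I) <= t. -/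
open scoped Classical

/-! ## The deglex order and up-sets in it -/

lemma deglexLT_iff_toColex_lt {n : ℕ} {a b : Mon n} : deglexLT a b ↔ toColex a < toColex b :=
  ⟨fun ⟨k, h, h'⟩ => ⟨k, h', h⟩, fun ⟨k, h', h⟩ => ⟨k, h, h'⟩⟩

lemma deglexLT.trans {n : ℕ} {a b c : Mon n} (hab : deglexLT a b) (hbc : deglexLT b c) :
    deglexLT a c := by
  rw [deglexLT_iff_toColex_lt] at *
  exact _root_.lt_trans hab hbc

lemma not_deglexLT_self {n : ℕ} (a : Mon n) : ¬ deglexLT a a := by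
  rw [deglexLT_iff_toColex_lt]
  exact lt_irrefl _

lemma deglexLT_trichotomy {n : ℕ} (a b : Mon n) : deglexLT a b ∨ a = b ∨ deglexLT b a := by
  simp only [deglexLT_iff_toColex_lt]
  exact lt_trichotomy (toColex a) (toColex b)

lemma exists_deglex_min {n : ℕ} {S : Finset (Mon n)} (hS : S.Nonempty) :
    ∃ m ∈ S, ∀ a ∈ S, ¬ deglexLT a m := by
  obtain ⟨m, hm, h⟩ := S.exists_min_image toColex hS
  exact ⟨m, hm, fun a ha hlt => (h a ha).not_gt (deglexLT_iff_toColex_lt.1 hlt)⟩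

lemma exists_deglex_max {n : ℕ} {S : Finset (Mon n)} (hS : S.Nonempty) :
    ∃ m ∈ S, ∀ a ∈ S, ¬ deglexLT m a := by
  obtain ⟨m, hm, h⟩ := S.exists_max_image toColex hS
  exact ⟨m, hm, fun a ha hlt => (h a ha).not_gt (deglexLT_iff_toColex_lt.1 hlt)⟩

/-- Between monomials of the same degree, a deglex increase is compensated at a smaller index. -/
lemma deglexLT.exists_lt {n : ℕ} {a b : Mon n} (h : deglexLT a b) (hd : mdeg a = mdeg b) :
    ∃ k l : Fin (n + 1), l < k ∧ a k < b k ∧ b l < a l ∧ ∀ i, k < i → a i = b i := by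
  obtain ⟨k, hk, hk'⟩ := h
  by_contra! hcon
  refine hd.not_lt (Finset.sum_lt_sum (fun i _ => ?_) ⟨k, Finset.mem_univ k, hk⟩)
  rcases lt_trichotomy i k with hi | rfl | hi
  · by_contra! hlt
    obtain ⟨j, hj, hne⟩ := hcon k i hi hk hlt
    exact hne (hk' j hj)
  · exact hk.le
  · exact (hk' i hi).le

/-- `U` is a deglex up-set (a lex-segment) inside `C`. -/
def UpperIn {n : ℕ} (C : Set (Mon n)) (U : Finset (Mon n)) : Prop :=
  ↑U ⊆ C ∧ ∀ a ∈ U, ∀ b ∈ C, deglexLT a b → b ∈ U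

lemma UpperIn.subset_of_card_le {n : ℕ} {C : Set (Mon n)} {U V : Finset (Mon n)}
    (hU : UpperIn C U) (hV : UpperIn C V) (h : U.card ≤ V.card) : U ⊆ V := by
  intro a ha
  by_contra hav
  have hVU : V ⊆ U := by
    intro v hv
    rcases deglexLT_trichotomy a v with h1 | rfl | h1
    · exact hU.2 a ha v (hV.1 hv) h1
    · exact ha
    · exact absurd (hV.2 v hv a (hU.1 ha) h1) hav
  exact (Finset.card_lt_card ⟨hVU, fun h' => hav (h' ha)⟩).not_ge h

lemma UpperIn.filter {n : ℕ} {C C' : Set (Mon n)} {U : Finset (Mon n)} (hU : UpperIn C U)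
    (hC : C' ⊆ C) {P : Mon n → Prop} [DecidablePred P]
    (hP : ∀ m ∈ C, P m ↔ m ∈ C') : UpperIn C' {m ∈ U | P m} := by
  refine ⟨fun m hm => ?_, fun a ha b hb hab => ?_⟩
  · rw [Finset.mem_coe, Finset.mem_filter] at hm
    exact (hP m (hU.1 hm.1)).1 hm.2
  · rw [Finset.mem_filter] at ha ⊢
    exact ⟨hU.2 a ha.1 b (hC hb) hab, (hP b (hC hb)).2 hb⟩

lemma exists_upperIn_card_eq {n : ℕ} (C : Finset (Mon n)) {g : ℕ} (hg : g ≤ C.card) :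
    ∃ U, UpperIn (C : Set (Mon n)) U ∧ U.card = g := by
  obtain ⟨d, hd⟩ := Nat.exists_eq_add_of_le hg
  induction d generalizing g with
  | zero => exact ⟨C, ⟨subset_rfl, fun _ _ b hb _ => hb⟩, hd⟩
  | succ d ih =>
    obtain ⟨U, hU, hUg⟩ := ih (g := g + 1) (by omega) (by omega)
    obtain ⟨m, hm, hmin⟩ := exists_deglex_min (S := U) (Finset.card_pos.1 (by omega))
    refine ⟨U.erase m, ⟨fun a ha => hU.1 (Finset.mem_of_mem_erase ha), fun a ha b hb hab => ?_⟩, ?_⟩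
    · have ha' := Finset.mem_of_mem_erase ha
      refine Finset.mem_erase.2 ⟨?_, hU.2 a ha' b hb hab⟩
      rintro rfl
      exact hmin a ha' hab
    · rw [Finset.card_erase_of_mem hm, hUg, Nat.add_sub_cancel]

/-! ## Moving exponents -/

/-- `m · x_q^r / x_p^r`. -/
def shift {n : ℕ} (m : Mon n) (p q : Fin (n + 1)) (r : ℕ) : Mon n :=
  fun l => if l = p then m l - r else if l = q then m l + r else m l

lemma shift_left {n : ℕ} (m : Mon n) (p q : Fin (n + 1)) (r : ℕ) : shift m p q r p = m p - r := by
  simp [shift]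

lemma shift_right {n : ℕ} (m : Mon n) {p q : Fin (n + 1)} (h : p ≠ q) (r : ℕ) :
    shift m p q r q = m q + r := by
  simp [shift, h.symm]

lemma shift_of_ne {n : ℕ} (m : Mon n) {p q l : Fin (n + 1)} (h : l ≠ p) (h' : l ≠ q) (r : ℕ) :
    shift m p q r l = m l := by
  simp [shift, h, h']

lemma shift_one {n : ℕ} (m : Mon n) (p q : Fin (n + 1)) : shift m p q 1 = borelStep m p q := rfl

lemma mdeg_shift {n : ℕ} {m : Mon n} {p q : Fin (n + 1)} {r : ℕ} (h : p ≠ q) (hr : r ≤ m p) :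
    mdeg (shift m p q r) = mdeg m := by
  have key : shift m p q r + Pi.single p r = m + Pi.single q r := by
    funext l
    by_cases h1 : l = p
    · subst h1
      simp [shift_left, h, hr]
    · by_cases h2 : l = q
      · subst h2
        simp [shift_right, h, h.symm]
      · simp [shift_of_ne, h1, h2]
  have h' : mdeg (shift m p q r + Pi.single p r) = mdeg (m + Pi.single q r) := by rw [key]
  simpa [mdeg, Finset.sum_add_distrib] using h'

lemma mdeg_borelStep {n : ℕ} {m : Mon n} {p q : Fin (n + 1)} (h : p ≠ q) (hr : 1 ≤ m p) :
    mdeg (borelStep m p q) = mdeg m :=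
  mdeg_shift h hr

lemma shift_shift {n : ℕ} {m : Mon n} {p q : Fin (n + 1)} {r : ℕ} (h : p ≠ q) (hr : r ≤ m p) :
    shift (shift m p q r) q p r = m := by
  funext l
  by_cases h1 : l = p
  · subst h1
    rw [shift_right _ h.symm, shift_left]
    omega
  · by_cases h2 : l = q
    · subst h2
      rw [shift_left, shift_right _ h]
      omega
    · rw [shift_of_ne _ h2 h1, shift_of_ne _ h1 h2]

lemma shift_injOn {n : ℕ} (p q : Fin (n + 1)) (r : ℕ) (h : p ≠ q) :
    Set.InjOn (fun m : Mon n => shift m p q r) {m | r ≤ m p} := by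
  intro a ha b hb hab
  rw [← shift_shift h ha, ← shift_shift h hb]
  exact congrArg (fun m => shift m q p r) hab

lemma card_le_card_of_shift_mem {n : ℕ} {S S' : Finset (Mon n)} {p q : Fin (n + 1)} {r : ℕ}
    (h : p ≠ q) (hS : ∀ u ∈ S, r ≤ u p ∧ shift u p q r ∈ S') : S.card ≤ S'.card :=
  Finset.card_le_card_of_injOn (fun u => shift u p q r) (fun u hu => (hS u hu).2)
    ((shift_injOn p q r h).mono fun u hu => (hS u hu).1)

lemma deglexLT_borelStep {n : ℕ} (m : Mon n) {p q : Fin (n + 1)} (h : p < q) :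
    deglexLT m (borelStep m p q) := by
  refine ⟨q, ?_, fun l hl => ?_⟩
  · rw [← shift_one, shift_right _ h.ne]
    omega
  · rw [← shift_one, shift_of_ne _ (h.trans hl).ne' hl.ne']

lemma shift_succ {n : ℕ} (m : Mon n) {p q : Fin (n + 1)} (h : p ≠ q) (r : ℕ) :
    shift m p q (r + 1) = borelStep (shift m p q r) p q := by
  funext l
  rw [← shift_one]
  by_cases h1 : l = p
  · subst h1
    simp only [shift_left]
    omega
  · by_cases h2 : l = q
    · subst h2
      simp only [shift_right _ h]
      omega
    · simp only [shift_of_ne _ h1 h2]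

/-! ## Borel sets, lex-segments and the exponent of the smallest free variable -/

/-- Degree-`t` monomials which agree with `f` below `p` and are divisible by `x_p^c`. -/
def prefixClass {n : ℕ} (t : ℕ) (f : Mon n) (p : Fin (n + 1)) (c : ℕ) : Set (Mon n) :=
  {m | mdeg m = t ∧ (∀ j < p, m j = f j) ∧ c ≤ m p}

/-- `A ⊆ C` is closed under those elementary Borel moves that stay inside `C`. -/
def BorelIn {n : ℕ} (C : Set (Mon n)) (A : Finset (Mon n)) : Prop :=
  ↑A ⊆ C ∧ ∀ a ∈ A, ∀ j i : Fin (n + 1), j < i → 1 ≤ a j → borelStep a j i ∈ C →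
    borelStep a j i ∈ A

lemma BorelIn.filter {n : ℕ} {C C' : Set (Mon n)} {A : Finset (Mon n)} (hA : BorelIn C A)
    (hC : C' ⊆ C) {P : Mon n → Prop} [DecidablePred P]
    (hP : ∀ m ∈ C, P m ↔ m ∈ C') : BorelIn C' {m ∈ A | P m} := by
  refine ⟨fun m hm => ?_, fun a ha j i hji haj hs => ?_⟩
  · rw [Finset.mem_coe, Finset.mem_filter] at hm
    exact (hP m (hA.1 hm.1)).1 hm.2
  · rw [Finset.mem_filter] at ha ⊢
    exact ⟨hA.2 a ha.1 j i hji haj (hC hs), (hP _ (hC hs)).2 hs⟩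

lemma BorelIn.shift_mem {n t : ℕ} {f : Mon n} {p q : Fin (n + 1)} {c : ℕ} {A : Finset (Mon n)}
    (hA : BorelIn (prefixClass t f p c) A) (hpq : p < q) {a : Mon n} (ha : a ∈ A) {r : ℕ}
    (hr : r + c ≤ a p) : shift a p q r ∈ A := by
  induction r with
  | zero =>
    have : shift a p q 0 = a := by
      funext l
      simp [shift]
    rwa [this]
  | succ r ih =>
    have h1 := ih (by omega)
    have hp : shift a p q r p = a p - r := shift_left a p q r
    rw [shift_succ _ hpq.ne]
    refine hA.2 _ h1 p q hpq (by omega) ⟨?_, fun j hj => ?_, ?_⟩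
    · rw [mdeg_borelStep hpq.ne (by omega)]
      exact (hA.1 h1).1
    · rw [← shift_one, shift_of_ne _ hj.ne (hj.trans hpq).ne]
      exact (hA.1 h1).2.1 j hj
    · rw [← shift_one, shift_left]
      omega

lemma card_filter_le_of_fiber_le {α : Type*} {S S' : Finset α} {g : α → ℕ} {P : ℕ → Prop}
    [DecidablePred P]
    (h : ∀ k, P k → {u ∈ S | g u = k}.card ≤ {u ∈ S' | g u = k}.card) :
    {u ∈ S | P (g u)}.card ≤ {u ∈ S' | P (g u)}.card := by
  have key : ∀ R : Finset α, R ⊆ S ∪ S' → {u ∈ R | P (g u)}.card =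
      ∑ k ∈ ((S ∪ S').image g).filter P, {u ∈ R | g u = k}.card := by
    intro R hR
    rw [Finset.card_eq_sum_card_fiberwise (f := g) (t := ((S ∪ S').image g).filter P)]
    · refine Finset.sum_congr rfl fun k hk => ?_
      rw [Finset.filter_filter]
      congr 1
      refine Finset.filter_congr fun u _ => ⟨fun hu => hu.2, fun hu => ⟨?_, hu⟩⟩
      rw [hu]
      exact (Finset.mem_filter.1 hk).2
    · intro u hu
      have hu' := Finset.mem_filter.1 hu
      exact Finset.mem_filter.2 ⟨Finset.mem_image_of_mem g (hR hu'.1), hu'.2⟩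
  rw [key S Finset.subset_union_left, key S' Finset.subset_union_right]
  exact Finset.sum_le_sum fun k hk => h k (Finset.mem_filter.1 hk).2

lemma eq_of_mem_prefixClass_last {n t c : ℕ} {f a b : Mon n}
    (ha : a ∈ prefixClass t f (Fin.last n) c) (hb : b ∈ prefixClass t f (Fin.last n) c) :
    a = b := by
  have h : ∀ a b : Mon n, a ∈ prefixClass t f (Fin.last n) c →
      b ∈ prefixClass t f (Fin.last n) c → ¬ deglexLT a b := by
    intro a b ha hb hab
    obtain ⟨k, l, hlk, -, hl, -⟩ := hab.exists_lt (ha.1.trans hb.1.symm)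
    have hl' : l < Fin.last n := hlk.trans_le (Fin.le_last k)
    rw [ha.2.1 l hl', hb.2.1 l hl'] at hl
    exact lt_irrefl _ hl
  rcases deglexLT_trichotomy a b with h1 | h1 | h1
  · exact absurd h1 (h a b ha hb)
  · exact h1
  · exact absurd h1 (h b a hb ha)

/-- The class of prefixes fixing moreover the exponent of `x_p`. -/
lemma mem_prefixClass_succ {n t : ℕ} {f : Mon n} {i : Fin n} {k c : ℕ} {m : Mon n} :
    m ∈ prefixClass t (Function.update f i.castSucc k) i.succ c ↔
      mdeg m = t ∧ (∀ j < i.castSucc, m j = f j) ∧ m i.castSucc = k ∧ c ≤ m i.succ := by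
  have : (∀ j < i.succ, m j = Function.update f i.castSucc k j) ↔
      (∀ j < i.castSucc, m j = f j) ∧ m i.castSucc = k := by
    constructor
    · intro h
      refine ⟨fun j hj => ?_, ?_⟩
      · rw [h j (hj.trans Fin.castSucc_lt_succ), Function.update_of_ne hj.ne]
      · rw [h _ Fin.castSucc_lt_succ, Function.update_self]
    · rintro ⟨h, h'⟩ j hj
      rcases (Fin.le_castSucc_iff.2 hj).lt_or_eq with hj' | rfl
      · rw [h j hj', Function.update_of_ne hj'.ne]
      · rw [h', Function.update_self]
  simp only [prefixClass, Set.mem_ofPred_eq, this, and_assoc]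

/-- Among Borel sets, lex-segments have the most elements with a large exponent of the smallest
free variable. -/
theorem card_filter_le_of_borelIn_of_upperIn {n t : ℕ} (p : Fin (n + 1)) :
    ∀ (c : ℕ) (f : Mon n) (A L : Finset (Mon n)), BorelIn (prefixClass t f p c) A →
      UpperIn (prefixClass t f p c) L → A.card ≤ L.card →
      ∀ s, {u ∈ A | s ≤ u p}.card ≤ {u ∈ L | s ≤ u p}.card := by
  induction p using Fin.reverseInduction with
  | last =>
    intro c f A L hA hL hAL s
    refine Finset.card_le_card (Finset.filter_subset_filter _ fun a ha => ?_)
    obtain ⟨l, hl⟩ := Finset.card_pos.1 ((Finset.card_pos.2 ⟨a, ha⟩).trans_le hAL)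
    rwa [eq_of_mem_prefixClass_last (hA.1 ha) (hL.1 hl)]
  | cast i ih =>
    intro c f A L hA hL hAL s
    set p := i.castSucc with hp
    set q := i.succ with hq
    have hpq : p < q := Fin.castSucc_lt_succ
    by_contra! hcon
    obtain ⟨k, hsk, hk⟩ : ∃ k, s ≤ k ∧ {u ∈ L | u p = k}.card < {u ∈ A | u p = k}.card := by
      by_contra! h
      exact hcon.not_ge (card_filter_le_of_fiber_le (P := fun k => s ≤ k) h)
    obtain ⟨e, hes, he⟩ : ∃ e, e < s ∧ {u ∈ A | u p = e}.card < {u ∈ L | u p = e}.card := by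
      by_contra! h
      have h1 := card_filter_le_of_fiber_le (P := fun k => ¬ s ≤ k) (g := fun u : Mon n => u p)
        (S := L) (S' := A) fun k hk => h k (not_le.1 hk)
      have h2 := Finset.card_filter_add_card_filter_not (s := A) (fun u : Mon n => s ≤ u p)
      have h3 := Finset.card_filter_add_card_filter_not (s := L) (fun u : Mon n => s ≤ u p)
      omega
    have hce : c ≤ e := by
      obtain ⟨u, hu⟩ := Finset.card_pos.1 (Nat.zero_lt_of_lt he)
      rw [Finset.mem_filter] at hu
      exact hu.2 ▸ (hL.1 hu.1).2.2
    set C := prefixClass t (Function.update f p e) q 0 with hC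
    have hCsub : C ⊆ prefixClass t f p c := fun m hm => by
      obtain ⟨h1, h2, h3, -⟩ := mem_prefixClass_succ.1 hm
      exact ⟨h1, h2, h3 ▸ hce⟩
    have hCmem : ∀ m ∈ prefixClass t f p c, m p = e ↔ m ∈ C := fun m hm =>
      ⟨fun h => mem_prefixClass_succ.2 ⟨hm.1, hm.2.1, h, Nat.zero_le _⟩,
        fun h => (mem_prefixClass_succ.1 h).2.2.1⟩
    have hAe := hA.filter hCsub hCmem
    have hLe := hL.filter hCsub hCmem
    obtain ⟨L', hL', hL'card⟩ := exists_upperIn_card_eq _ he.le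
    have hL'C : UpperIn C L' := by
      refine ⟨fun a ha => hLe.1 (hL'.1 ha), fun a ha b hb hab => ?_⟩
      exact hL'.2 a ha b (hLe.2 a (hL'.1 ha) b hb hab) hab
    obtain ⟨m, hmL, hmL'⟩ : ∃ m ∈ {u ∈ L | u p = e}, m ∉ L' := by
      by_contra! h
      exact (Finset.card_le_card h).not_gt (by omega)
    have hgt : ∀ u ∈ L', deglexLT m u := by
      intro u hu
      rcases deglexLT_trichotomy m u with h | rfl | h
      · exact h
      · exact absurd hu hmL'
      · exact absurd (hL'C.2 u hu m (hLe.1 hmL) h) hmL'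
    have hmC := mem_prefixClass_succ.1 (hLe.1 hmL)
    have h1 : {u ∈ A | u p = k}.card ≤ {u ∈ {u ∈ A | u p = e} | k - e ≤ u q}.card := by
      refine card_le_card_of_shift_mem (r := k - e) hpq.ne fun u hu => ?_
      obtain ⟨hu, huk⟩ := Finset.mem_filter.1 hu
      refine ⟨by omega, Finset.mem_filter.2 ⟨Finset.mem_filter.2
        ⟨hA.shift_mem hpq hu (by omega), ?_⟩, ?_⟩⟩
      · rw [shift_left]
        omega
      · rw [shift_right _ hpq.ne]
        omega
    have h2 := ih 0 (Function.update f p e) _ L' hAe hL'C hL'card.ge (k - e)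
    have h3 : {u ∈ L' | k - e ≤ u q}.card ≤ {u ∈ L | u p = k}.card := by
      refine card_le_card_of_shift_mem (r := k - e) hpq.ne' fun u hu => ?_
      obtain ⟨hu, huk⟩ := Finset.mem_filter.1 hu
      have huC := mem_prefixClass_succ.1 (hL'C.1 hu)
      have hup : shift u q p (k - e) p = k := by
        rw [shift_right _ hpq.ne', huC.2.2.1]
        omega
      refine ⟨huk, Finset.mem_filter.2 ⟨hL.2 m (Finset.mem_filter.1 hmL).1 _
        ⟨?_, fun j hj => ?_, ?_⟩ ?_, hup⟩⟩
      · rw [mdeg_shift hpq.ne' huk]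
        exact huC.1
      · rw [shift_of_ne _ (hj.trans hpq).ne hj.ne]
        exact huC.2.1 j hj
      · omega
      · obtain ⟨a, b, hba, ha, hb, hab⟩ := (hgt u hu).exists_lt (hmC.1.trans huC.1.symm)
        have hqb : q ≤ b := by
          by_contra! hbq
          rcases (Fin.le_castSucc_iff.2 hbq).lt_or_eq with hb' | hb'
          · rw [huC.2.1 b hb', hmC.2.1 b hb'] at hb
            exact lt_irrefl _ hb
          · rw [hb', huC.2.2.1, hmC.2.2.1] at hb
            exact lt_irrefl _ hb
        have hsh : ∀ j, q < j → shift u q p (k - e) j = u j := fun j hj =>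
          shift_of_ne _ hj.ne' (hpq.trans hj).ne' _
        refine ⟨a, ?_, fun j hj => ?_⟩
        · rwa [hsh a (hqb.trans_lt hba)]
        · rw [hsh j ((hqb.trans_lt hba).trans hj)]
          exact hab j hj
    omega

/-- An injection-by-counting principle: a lex-segment of prefix-`(f, k + 1)` monomials is carried
by `x_p ↦ x_{p+1}` into any lex-segment of at least the same size of prefix-`(f, k)` monomials
divisible by `x_{p+1}`. -/
lemma UpperIn.borelStep_mem {n t k : ℕ} {f : Mon n} {i : Fin n} {U V : Finset (Mon n)}
    (hU : UpperIn (prefixClass t (Function.update f i.castSucc (k + 1)) i.succ 0) U)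
    (hV : UpperIn (prefixClass t (Function.update f i.castSucc k) i.succ 1) V)
    (hUV : U.card ≤ V.card) {a : Mon n} (ha : a ∈ U) : borelStep a i.castSucc i.succ ∈ V := by
  set p := i.castSucc with hp
  set q := i.succ with hq
  have hpq : p < q := Fin.castSucc_lt_succ
  have hUp : ∀ u ∈ U, 1 ≤ u p := fun u hu => by
    rw [(mem_prefixClass_succ.1 (hU.1 hu)).2.2.1]
    omega
  have himg : UpperIn (prefixClass t (Function.update f p k) q 1)
      (U.image fun u => shift u p q 1) := by
    refine ⟨fun m hm => ?_, fun m hm b hb hmb => ?_⟩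
    · obtain ⟨u, hu, rfl⟩ := Finset.mem_image.1 hm
      have huC := mem_prefixClass_succ.1 (hU.1 hu)
      refine mem_prefixClass_succ.2 ⟨?_, fun j hj => ?_, ?_, ?_⟩
      · rw [mdeg_shift hpq.ne (hUp u hu)]
        exact huC.1
      · rw [shift_of_ne _ hj.ne (hj.trans hpq).ne]
        exact huC.2.1 j hj
      · rw [shift_left, huC.2.2.1]
        rfl
      · rw [shift_right _ hpq.ne]
        omega
    · obtain ⟨u, hu, rfl⟩ := Finset.mem_image.1 hm
      have huC := mem_prefixClass_succ.1 (hU.1 hu)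
      have hbC := mem_prefixClass_succ.1 hb
      refine Finset.mem_image.2 ⟨shift b q p 1, hU.2 u hu _ ?_ ?_, shift_shift hpq.ne' hbC.2.2.2⟩
      · refine mem_prefixClass_succ.2 ⟨?_, fun j hj => ?_, ?_, Nat.zero_le _⟩
        · rw [mdeg_shift hpq.ne' hbC.2.2.2]
          exact hbC.1
        · rw [shift_of_ne _ (hj.trans hpq).ne hj.ne]
          exact hbC.2.1 j hj
        · rw [shift_right _ hpq.ne', hbC.2.2.1]
      · obtain ⟨e, he, he'⟩ := hmb
        have hagree : ∀ j, j ≠ p → j ≠ q →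
            shift u p q 1 j = u j ∧ shift b q p 1 j = b j := fun j h1 h2 =>
          ⟨shift_of_ne _ h1 h2 _, shift_of_ne _ h2 h1 _⟩
        have hbq : shift b q p 1 q = b q - 1 := shift_left _ _ _ _
        have huq : shift u p q 1 q = u q + 1 := shift_right _ hpq.ne _
        have hbq1 : 1 ≤ b q := hbC.2.2.2
        refine ⟨e, ?_, fun j hj => ?_⟩
        · rcases eq_or_ne e q with rfl | heq
          · omega
          · have hep : p < e := by
              by_contra! hep
              rcases hep.lt_or_eq with hep | rfl
              · rw [(hagree e hep.ne heq).1, huC.2.1 e hep, hbC.2.1 e hep] at he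
                exact lt_irrefl _ he
              · rw [shift_left, huC.2.2.1, hbC.2.2.1] at he
                omega
            rw [(hagree e hep.ne' heq).2]
            rwa [(hagree e hep.ne' heq).1] at he
        · have hje := he' j hj
          rcases eq_or_ne j q with rfl | hjq
          · omega
          · rcases eq_or_ne j p with rfl | hjp
            · rw [shift_right _ hpq.ne', huC.2.2.1, hbC.2.2.1]
            · rwa [(hagree j hjp hjq).2, ← (hagree j hjp hjq).1]
  refine himg.subset_of_card_le hV ?_ (Finset.mem_image_of_mem (fun u => shift u p q 1) ha)
  exact Finset.card_image_le.trans hUV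

/-! ## Joint growth and height classes -/

/-- The invariant of a monomial recording its exponent of `x_0` and its smallest variable. -/
def levelKey {n : ℕ} (m : Mon n) : ℕ × (Fin (n + 1) → Prop) :=
  (m 0, fun j => ∃ l ≤ j, 1 ≤ m l)

lemma levelKey_eq_iff {n : ℕ} {a b : Mon n} : levelKey a = levelKey b ↔
    a 0 = b 0 ∧ ∀ j, (∃ l ≤ j, 1 ≤ a l) ↔ ∃ l ≤ j, 1 ≤ b l := by
  simp [levelKey, funext_iff]

lemma levelKey_eq_of_pos {n : ℕ} {a b : Mon n} (ha : 1 ≤ a 0) (h : a 0 = b 0) :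
    levelKey a = levelKey b :=
  levelKey_eq_iff.2 ⟨h, fun j => iff_of_true ⟨0, Fin.zero_le j, ha⟩ ⟨0, Fin.zero_le j, h ▸ ha⟩⟩

lemma levelKey_eq_iff_of_min {n : ℕ} {a b : Mon n} {i : Fin (n + 1)} (hi : i ≠ 0) (hai : 1 ≤ a i)
    (ha : ∀ j < i, a j = 0) : levelKey a = levelKey b ↔ 1 ≤ b i ∧ ∀ j < i, b j = 0 := by
  have h0 : 0 < i := Fin.pos_of_ne_zero hi
  rw [levelKey_eq_iff]
  constructor
  · rintro ⟨-, h⟩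
    have hb : ∀ j < i, b j = 0 := by
      intro j hj
      by_contra hbj
      obtain ⟨l, hl, hal⟩ := (h j).2 ⟨j, le_rfl, Nat.one_le_iff_ne_zero.2 hbj⟩
      have := ha l (hl.trans_lt hj)
      omega
    obtain ⟨l, hl, hbl⟩ := (h i).1 ⟨i, le_rfl, hai⟩
    rcases hl.lt_or_eq with hl | rfl
    · have := hb l hl
      omega
    · exact ⟨hbl, hb⟩
  · rintro ⟨hbi, hb⟩
    refine ⟨by rw [ha 0 h0, hb 0 h0], fun j => ?_⟩
    rcases lt_or_ge j i with hj | hj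
    · refine iff_of_false ?_ ?_
      · rintro ⟨l, hl, h⟩
        have := ha l (hl.trans_lt hj)
        omega
      · rintro ⟨l, hl, h⟩
        have := hb l (hl.trans_lt hj)
        omega
    · exact iff_of_true ⟨i, hj, hai⟩ ⟨i, hj, hbi⟩

/-- `C` is empty or a full class of degree-`t` monomials with a given `levelKey`. -/
def IsKeyClass {n : ℕ} (t : ℕ) (C : Set (Mon n)) : Prop :=
  C ⊆ Tset n t ∧ ∀ a ∈ C, ∀ b ∈ Tset n t, levelKey a = levelKey b ↔ b ∈ C

/-- Each class of `L` with a given `levelKey` is a lex-segment. -/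
def KeyLex {n : ℕ} (t : ℕ) (L : Finset (Mon n)) : Prop :=
  ↑L ⊆ Tset n t ∧
    ∀ a ∈ L, ∀ b ∈ Tset n t, levelKey a = levelKey b → deglexLT a b → b ∈ L

/-- `A` and `B` have equally many elements with each value of `levelKey`. -/
def SameKeys {n : ℕ} (A B : Finset (Mon n)) : Prop :=
  ∀ v, {a ∈ A | levelKey a = v}.card = {b ∈ B | levelKey b = v}.card

lemma isKeyClass_prefixClass_growth {n : ℕ} (t : ℕ) {i : Fin (n + 1)} (hi : i ≠ 0) :
    IsKeyClass t (prefixClass t 0 i 1) := by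
  refine ⟨fun m hm => hm.1, fun a ha b hb => ?_⟩
  rw [levelKey_eq_iff_of_min hi ha.2.2 ha.2.1]
  exact ⟨fun h => ⟨hb, h.2, h.1⟩, fun h => ⟨h.2.2, h.2.1⟩⟩

lemma isKeyClass_prefixClass_height {n : ℕ} (t : ℕ) {i : Fin n} (hi : i.castSucc = 0) (k : ℕ) :
    IsKeyClass t (prefixClass t (Function.update 0 i.castSucc (k + 1)) i.succ 0) := by
  refine ⟨fun m hm => hm.1, fun a ha b hb => ?_⟩
  rw [mem_prefixClass_succ] at ha ⊢
  rw [hi] at ha ⊢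
  have h0 : a 0 = k + 1 := ha.2.2.1
  constructor
  · intro h
    refine ⟨hb, fun j hj => absurd hj (Fin.not_lt_zero j), ?_, Nat.zero_le _⟩
    rw [← (levelKey_eq_iff.1 h).1, h0]
  · intro h
    exact levelKey_eq_of_pos (by omega) (h0.trans h.2.2.1.symm)

lemma KeyLex.upperIn {n t : ℕ} {L : Finset (Mon n)} (hL : KeyLex t L) {C : Set (Mon n)}
    (hC : IsKeyClass t C) : UpperIn C {m ∈ L | m ∈ C} := by
  refine ⟨fun m hm => (Finset.mem_filter.1 hm).2, fun a ha b hb hab => ?_⟩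
  rw [Finset.mem_filter] at ha ⊢
  exact ⟨hL.2 a ha.1 b (hC.1 hb) ((hC.2 a ha.2 b (hC.1 hb)).2 hb) hab, hb⟩

lemma SameKeys.card_eq {n t : ℕ} {A B : Finset (Mon n)} (h : SameKeys A B)
    (hA : ↑A ⊆ Tset n t) (hB : ↑B ⊆ Tset n t) {C : Set (Mon n)} (hC : IsKeyClass t C) :
    {a ∈ A | a ∈ C}.card = {b ∈ B | b ∈ C}.card := by
  rcases C.eq_empty_or_nonempty with rfl | ⟨c, hc⟩
  · simp
  · have key : ∀ R : Finset (Mon n), ↑R ⊆ Tset n t →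
        {a ∈ R | a ∈ C} = {a ∈ R | levelKey a = levelKey c} := fun R hR =>
      Finset.filter_congr fun a ha => by rw [← hC.2 c hc a (hR ha), eq_comm]
    rw [key A hA, key B hB]
    exact h _

lemma mem_of_adjacent {n : ℕ} {L : Finset (Mon n)}
    (h : ∀ a ∈ L, ∀ i : Fin n, 1 ≤ a i.castSucc → borelStep a i.castSucc i.succ ∈ L)
    {a : Mon n} (ha : a ∈ L) {j i : Fin (n + 1)} (hji : j < i) (haj : 1 ≤ a j) :
    borelStep a j i ∈ L := by
  induction i using Fin.induction with
  | zero => exact absurd hji (Fin.not_lt_zero j)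
  | succ i ih =>
    rcases (Fin.le_castSucc_iff.2 hji).lt_or_eq with hlt | rfl
    · have h2 := h _ (ih hlt) i (by
        rw [← shift_one, shift_right _ hlt.ne]
        omega)
      have : borelStep (borelStep a j i.castSucc) i.castSucc i.succ = borelStep a j i.succ := by
        have hs : i.castSucc < i.succ := Fin.castSucc_lt_succ
        funext l
        by_cases h1 : l = j
        · subst h1
          simp [borelStep, hlt.ne, hji.ne]
        · by_cases h3 : l = i.castSucc
          · subst h3
            simp [borelStep, hlt.ne', hs.ne]
          · simp [borelStep, h1, h3]
      rwa [this] at h2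
    · exact h a ha i haj

lemma isBorelSet_coe_iff {n t : ℕ} {L : Finset (Mon n)} :
    IsBorelSet t (L : Set (Mon n)) ↔ BorelIn (Tset n t) L := by
  constructor
  · rintro ⟨h1, h2⟩
    exact ⟨h1, fun a ha j i hji haj _ => h2 a ha _ (Relation.ReflTransGen.single
      ⟨j, i, hji, haj, rfl⟩)⟩
  · rintro ⟨h1, h2⟩
    refine ⟨h1, fun a ha b hab => ?_⟩
    induction hab with
    | refl => exact ha
    | tail _ hbc ih =>
      obtain ⟨j, i, hji, hbj, rfl⟩ := hbc
      exact h2 _ ih j i hji hbj ((mdeg_borelStep hji.ne hbj).trans (h1 ih))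

/-- A set of monomials with lexicographic classes and the class sizes of a Borel set is Borel. -/
theorem KeyLex.borelIn {n t : ℕ} {B L : Finset (Mon n)} (hB : BorelIn (Tset n t) B)
    (hL : KeyLex t L) (hBL : SameKeys B L) : BorelIn (Tset n t) L := by
  refine ⟨hL.1, fun a ha j i hji haj _ => mem_of_adjacent ?_ ha hji haj⟩
  clear! a j i
  intro a ha i hai
  set p := i.castSucc with hp
  set q := i.succ with hq
  have hpq : p < q := Fin.castSucc_lt_succ
  have hq0 : q ≠ 0 := i.succ_ne_zero
  have hdeg : borelStep a p q ∈ Tset n t := (mdeg_borelStep hpq.ne hai).trans (hL.1 ha)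
  have hsucc : ∀ l, l ≠ p → a l ≤ borelStep a p q l := by
    intro l hl
    rw [← shift_one]
    by_cases hlq : l = q
    · subst hlq
      rw [shift_right _ hpq.ne]
      omega
    · rw [shift_of_ne _ hl hlq]
  by_cases hkey : levelKey a = levelKey (borelStep a p q)
  · exact hL.2 a ha _ hdeg hkey (deglexLT_borelStep a hpq)
  have hbelow : ∀ l < p, a l = 0 := by
    intro l hl
    by_contra hne
    refine hkey (levelKey_eq_iff.2 ⟨?_, fun j => ?_⟩)
    · rw [← shift_one, shift_of_ne _ ((Fin.zero_le l).trans_lt hl).ne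
        (((Fin.zero_le l).trans_lt hl).trans hpq).ne]
    · rcases lt_or_ge j p with hj | hj
      · refine exists_congr fun l' => and_congr_right fun hl' => ?_
        rw [← shift_one, shift_of_ne _ (hl'.trans_lt hj).ne ((hl'.trans_lt hj).trans hpq).ne]
      · exact iff_of_true ⟨p, hj, hai⟩
          ⟨l, hl.le.trans hj, (Nat.one_le_iff_ne_zero.2 hne).trans (hsucc l hl.ne)⟩
  obtain ⟨k, hk⟩ := Nat.exists_eq_add_of_le' hai
  set C₁ := prefixClass t (Function.update 0 p (k + 1)) q 0 with hC₁
  set C₂ := prefixClass t (Function.update 0 p k) q 1 with hC₂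
  have hB12 : {u ∈ B | u ∈ C₁}.card ≤ {u ∈ B | u ∈ C₂}.card := by
    refine card_le_card_of_shift_mem (r := 1) hpq.ne fun u hu => ?_
    obtain ⟨hu, huC⟩ := Finset.mem_filter.1 hu
    obtain ⟨h1, h2, h3, -⟩ := mem_prefixClass_succ.1 huC
    have hup : 1 ≤ u p := by
      rw [h3]
      omega
    have hd := mdeg_borelStep hpq.ne hup
    refine ⟨hup, Finset.mem_filter.2 ⟨hB.2 u hu p q hpq hup (hd.trans h1), ?_⟩⟩
    refine mem_prefixClass_succ.2 ⟨hd.trans h1, fun j hj => ?_, ?_, ?_⟩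
    · rw [shift_of_ne _ hj.ne (hj.trans hpq).ne]
      exact h2 j hj
    · rw [shift_left, h3]
      rfl
    · rw [shift_right _ hpq.ne]
      omega
  suffices h : (UpperIn C₁ {u ∈ L | u ∈ C₁} ∧ {u ∈ L | u ∈ C₁}.card ≤ {u ∈ B | u ∈ C₁}.card) ∧
      (UpperIn C₂ {u ∈ L | u ∈ C₂} ∧ {u ∈ B | u ∈ C₂}.card ≤ {u ∈ L | u ∈ C₂}.card) by
    obtain ⟨⟨h1, h2⟩, h3, h4⟩ := h
    refine (Finset.mem_filter.1 (h1.borelStep_mem h3 (h2.trans (hB12.trans h4))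
      (Finset.mem_filter.2 ⟨ha, ?_⟩))).1
    exact mem_prefixClass_succ.2 ⟨hL.1 ha, hbelow, hk, Nat.zero_le _⟩
  have hgrowth : k = 0 →
      UpperIn C₂ {u ∈ L | u ∈ C₂} ∧ {u ∈ B | u ∈ C₂}.card ≤ {u ∈ L | u ∈ C₂}.card := by
    rintro rfl
    have hC : IsKeyClass t C₂ := by
      have h0 : Function.update (0 : Mon n) p 0 = 0 := Function.update_eq_self p _
      rw [hC₂, h0]
      exact isKeyClass_prefixClass_growth t hq0
    exact ⟨hL.upperIn hC, (hBL.card_eq hB.1 hL.1 hC).le⟩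
  have hcompare : ∀ {f : Mon n} {r : Fin (n + 1)} {c : ℕ}, IsKeyClass t (prefixClass t f r c) →
      ∀ s, {u ∈ {u ∈ B | u ∈ prefixClass t f r c} | s ≤ u r}.card ≤
        {u ∈ {u ∈ L | u ∈ prefixClass t f r c} | s ≤ u r}.card := by
    intro f r c hC s
    exact card_filter_le_of_borelIn_of_upperIn r c f _ _ (hB.filter hC.1 fun _ _ => Iff.rfl)
      (hL.upperIn hC) (hBL.card_eq hB.1 hL.1 hC).le s
  by_cases hp0 : p = 0
  · refine ⟨?_, ?_⟩
    · have hC : IsKeyClass t C₁ := isKeyClass_prefixClass_height t hp0 k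
      exact ⟨hL.upperIn hC, (hBL.card_eq hB.1 hL.1 hC).ge⟩
    · rcases k with - | k
      · exact hgrowth rfl
      · have hC : IsKeyClass t (prefixClass t (Function.update 0 p (k + 1)) q 0) :=
          isKeyClass_prefixClass_height t hp0 k
        have hiff : ∀ m, m ∈ C₂ ↔
            m ∈ prefixClass t (Function.update 0 p (k + 1)) q 0 ∧ 1 ≤ m q := by
          intro m
          rw [hC₂, mem_prefixClass_succ, mem_prefixClass_succ]
          exact ⟨fun ⟨h1, h2, h3, h4⟩ => ⟨⟨h1, h2, h3, Nat.zero_le _⟩, h4⟩,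
            fun ⟨⟨h1, h2, h3, _⟩, h4⟩ => ⟨h1, h2, h3, h4⟩⟩
        have hfilter : ∀ R : Finset (Mon n), {u ∈ R | u ∈ C₂} =
            {u ∈ {u ∈ R | u ∈ prefixClass t (Function.update 0 p (k + 1)) q 0} | 1 ≤ u q} := by
          intro R
          rw [Finset.filter_filter]
          exact Finset.filter_congr fun u _ => hiff u
        rw [hfilter B, hfilter L]
        exact ⟨(hL.upperIn hC).filter (fun m hm => ((hiff m).1 hm).1)
          fun m hm => ⟨fun h => (hiff m).2 ⟨hm, h⟩, fun h => ((hiff m).1 h).2⟩, hcompare hC 1⟩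
  · have hk0 : k = 0 := by
      by_contra hk0
      refine hkey ((levelKey_eq_iff_of_min hp0 hai hbelow).2 ⟨?_, fun j hj => ?_⟩)
      · rw [← shift_one, shift_left]
        omega
      · rw [← shift_one, shift_of_ne _ hj.ne (hj.trans hpq).ne]
        exact hbelow j hj
    refine ⟨?_, hgrowth hk0⟩
    subst hk0
    have hC : IsKeyClass t (prefixClass t 0 p 1) := isKeyClass_prefixClass_growth t hp0
    have hiff : ∀ m, m ∈ C₁ ↔ m ∈ prefixClass t 0 p 1 ∧ ¬ 2 ≤ m p := by
      intro m
      rw [hC₁, mem_prefixClass_succ]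
      constructor
      · rintro ⟨h1, h2, h3, -⟩
        have h3' : m p = 0 + 1 := h3
        exact ⟨⟨h1, h2, h3'.ge⟩, by omega⟩
      · rintro ⟨⟨h1, h2, h3⟩, h4⟩
        have h5 : m p = 0 + 1 := by omega
        exact ⟨h1, h2, h5, Nat.zero_le _⟩
    have hfilter : ∀ R : Finset (Mon n), {u ∈ R | u ∈ C₁} =
        {u ∈ {u ∈ R | u ∈ prefixClass t 0 p 1} | ¬ 2 ≤ u p} := by
      intro R
      rw [Finset.filter_filter]
      exact Finset.filter_congr fun u _ => hiff u
    rw [hfilter B, hfilter L]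
    refine ⟨(hL.upperIn hC).filter (fun m hm => ((hiff m).1 hm).1)
      fun m hm => ⟨fun h => (hiff m).2 ⟨hm, h⟩, fun h => ((hiff m).1 h).2⟩, ?_⟩
    have h1 := hcompare hC 2
    have h2 := hBL.card_eq hB.1 hL.1 hC
    have h3 := Finset.card_filter_add_card_filter_not (s := {u ∈ B | u ∈ prefixClass t 0 p 1})
      (fun u : Mon n => 2 ≤ u p)
    have h4 := Finset.card_filter_add_card_filter_not (s := {u ∈ L | u ∈ prefixClass t 0 p 1})
      (fun u : Mon n => 2 ≤ u p)
    omega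

/-- The finite set of terms of degree `t`. -/
def termFinset (n t : ℕ) : Finset (Mon n) := Finset.piAntidiag Finset.univ t

lemma mem_termFinset {n t : ℕ} {m : Mon n} : m ∈ termFinset n t ↔ mdeg m = t := by
  simp [termFinset, mdeg]

lemma eq_zero_of_mdeg_eq_zero {n : ℕ} {m : Mon n} (h : mdeg m = 0) : m = 0 := by
  funext i
  exact Finset.sum_eq_zero_iff.1 h i (Finset.mem_univ i)

lemma exists_min_index {n : ℕ} (m : Mon n) :
    m = 0 ∨ ∃ i, 1 ≤ m i ∧ ∀ j < i, m j = 0 := by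
  by_cases h : ∃ i, 1 ≤ m i
  · obtain ⟨i, hi, hmin⟩ := WellFounded.has_min (wellFounded_lt (α := Fin (n + 1))) {i | 1 ≤ m i} h
    refine Or.inr ⟨i, hi, fun j hj => ?_⟩
    by_contra hne
    exact hmin j (Nat.one_le_iff_ne_zero.2 hne) hj
  · push Not at h
    exact Or.inl (funext fun i => Nat.lt_one_iff.1 (h i))

lemma isKeyClass_key {n : ℕ} (t : ℕ) (v : ℕ × (Fin (n + 1) → Prop)) :
    IsKeyClass t {m : Mon n | mdeg m = t ∧ levelKey m = v} :=
  ⟨fun _ hm => hm.1, fun _ ha _ hb => ⟨fun h => ⟨hb, h ▸ ha.2⟩, fun h => ha.2.trans h.2.symm⟩⟩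

lemma exists_keyLex {n t : ℕ} {B : Finset (Mon n)} (hB : ↑B ⊆ Tset n t) :
    ∃ L, KeyLex t L ∧ SameKeys B L := by
  have hsub : ∀ v, {b ∈ B | levelKey b = v}.card ≤ {m ∈ termFinset n t | levelKey m = v}.card :=
    fun v => Finset.card_le_card (Finset.filter_subset_filter _ fun b hb =>
      mem_termFinset.2 (hB hb))
  choose U hU hUcard using fun v => exists_upperIn_card_eq _ (hsub v)
  have hUmem : ∀ v m, m ∈ U v → mdeg m = t ∧ levelKey m = v := fun v m hm => by
    have := Finset.mem_filter.1 ((hU v).1 hm)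
    exact ⟨mem_termFinset.1 this.1, this.2⟩
  refine ⟨{m ∈ termFinset n t | m ∈ U (levelKey m)}, ⟨fun m hm => ?_, ?_⟩, fun v => ?_⟩
  · exact mem_termFinset.1 (Finset.mem_filter.1 hm).1
  · intro a ha b hb hab hlt
    rw [Finset.mem_filter] at ha ⊢
    refine ⟨mem_termFinset.2 hb, ?_⟩
    rw [← hab]
    exact (hU _).2 a ha.2 b (Finset.mem_filter.2 ⟨mem_termFinset.2 hb, hab.symm⟩) hlt
  · rw [← hUcard v]
    congr 1
    ext m
    rw [Finset.mem_filter, Finset.mem_filter, mem_termFinset]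
    constructor
    · intro h
      exact ⟨⟨(hUmem v m h).1, (hUmem v m h).2 ▸ h⟩, (hUmem v m h).2⟩
    · rintro ⟨⟨-, h⟩, rfl⟩
      exact h

lemma KeyLex.subset_of_sameKeys {n t : ℕ} {L L' : Finset (Mon n)} (hL : KeyLex t L)
    (hL' : KeyLex t L') (h : SameKeys L L') : L ⊆ L' := by
  intro a ha
  obtain ⟨C, hC, haC⟩ : ∃ C, IsKeyClass t C ∧ a ∈ C :=
    ⟨_, isKeyClass_key t (levelKey a), hL.1 ha, rfl⟩
  exact (Finset.mem_filter.1 ((hL.upperIn hC).subset_of_card_le (hL'.upperIn hC)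
    (h.card_eq hL.1 hL'.1 hC).le (Finset.mem_filter.2 ⟨ha, haC⟩))).1

lemma KeyLex.eq_of_sameKeys {n t : ℕ} {L L' : Finset (Mon n)} (hL : KeyLex t L)
    (hL' : KeyLex t L') (h : SameKeys L L') : L = L' :=
  (hL.subset_of_sameKeys hL' h).antisymm (hL'.subset_of_sameKeys hL fun v => (h v).symm)

lemma SameKeys.sum_eq {n t : ℕ} {A B : Finset (Mon n)} (h : SameKeys A B) (hA : ↑A ⊆ Tset n t)
    (hB : ↑B ⊆ Tset n t) {F : Mon n → ℕ}
    (hF : ∀ a ∈ Tset n t, ∀ b ∈ Tset n t, levelKey a = levelKey b → F a = F b) :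
    ∑ a ∈ A, F a = ∑ b ∈ B, F b := by
  rw [← Finset.sum_fiberwise_of_maps_to (g := levelKey) (t := (A ∪ B).image levelKey)
      fun a ha => Finset.mem_image_of_mem _ (Finset.mem_union_left _ ha),
    ← Finset.sum_fiberwise_of_maps_to (s := B) (g := levelKey) (t := (A ∪ B).image levelKey)
      fun b hb => Finset.mem_image_of_mem _ (Finset.mem_union_right _ hb)]
  refine Finset.sum_congr rfl fun v hv => ?_
  obtain ⟨c, hc, rfl⟩ := Finset.mem_image.1 hv
  have hct : c ∈ Tset n t := (Finset.mem_union.1 hc).elim (fun h => hA h) fun h => hB h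
  have key : ∀ R : Finset (Mon n), ↑R ⊆ Tset n t → ∑ a ∈ R with levelKey a = levelKey c, F a =
      {a ∈ R | levelKey a = levelKey c}.card * F c := fun R hR => by
    rw [Finset.sum_congr rfl fun a ha =>
      hF a (hR (Finset.mem_filter.1 ha).1) c hct (Finset.mem_filter.1 ha).2]
    simp
  rw [key A hA, key B hB, h]

lemma SameKeys.card_filter_eq {n t : ℕ} {A B : Finset (Mon n)} (h : SameKeys A B)
    (hA : ↑A ⊆ Tset n t) (hB : ↑B ⊆ Tset n t) {P : Mon n → Prop} [DecidablePred P]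
    (hP : ∀ a b, levelKey a = levelKey b → (P a ↔ P b)) :
    {a ∈ A | P a}.card = {b ∈ B | P b}.card := by
  rw [Finset.card_filter, Finset.card_filter]
  exact h.sum_eq hA hB fun a _ b _ hab => by simp only [hP a b hab]

lemma growthClass_coe {n : ℕ} (A : Finset (Mon n)) (i : Fin (n + 1)) :
    growthClass (A : Set (Mon n)) i = ↑{m ∈ A | 1 ≤ m i ∧ ∀ j < i, m j = 0} := by
  ext m
  simp [growthClass]

lemma heightClass_coe {n : ℕ} (A : Finset (Mon n)) (i : ℕ) :
    heightClass (A : Set (Mon n)) i = ↑{m ∈ A | m 0 = i} := by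
  ext m
  simp [heightClass]

lemma sameKeys_iff {n t : ℕ} {A B : Finset (Mon n)} (hA : ↑A ⊆ Tset n t) (hB : ↑B ⊆ Tset n t) :
    SameKeys A B ↔
      (∀ i : Fin (n + 1), (growthClass (A : Set (Mon n)) i).ncard =
        (growthClass (B : Set (Mon n)) i).ncard) ∧
      ∀ i : ℕ, (heightClass (A : Set (Mon n)) i).ncard =
        (heightClass (B : Set (Mon n)) i).ncard := by
  simp only [growthClass_coe, heightClass_coe, Set.ncard_coe_finset]
  constructor
  · refine fun h => ⟨fun i => h.card_filter_eq hA hB fun a b hab => ?_,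
      fun i => h.card_filter_eq hA hB fun a b hab => by rw [(levelKey_eq_iff.1 hab).1]⟩
    have key : ∀ m : Mon n, (1 ≤ m i ∧ ∀ j < i, m j = 0) ↔
        (∃ l ≤ i, 1 ≤ m l) ∧ ∀ j < i, ¬ ∃ l ≤ j, 1 ≤ m l := by
      intro m
      constructor
      · rintro ⟨h1, h2⟩
        refine ⟨⟨i, le_rfl, h1⟩, ?_⟩
        rintro j hj ⟨l, hl, h3⟩
        rw [h2 l (hl.trans_lt hj)] at h3
        omega
      · rintro ⟨⟨l, hl, h1⟩, h2⟩
        have h3 : ∀ j < i, m j = 0 := fun j hj => by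
          by_contra hne
          exact h2 j hj ⟨j, le_rfl, Nat.one_le_iff_ne_zero.2 hne⟩
        rcases hl.lt_or_eq with hl | rfl
        · rw [h3 l hl] at h1
          omega
        · exact ⟨h1, h3⟩
    rw [key, key]
    simp only [(levelKey_eq_iff.1 hab).2]
  · rintro ⟨hg, hh⟩ v
    by_cases hv : ∃ c ∈ Tset n t, levelKey c = v
    · obtain ⟨c, hc, rfl⟩ := hv
      suffices h : (∃ i : Fin (n + 1), ∀ m ∈ Tset n t,
          levelKey m = levelKey c ↔ 1 ≤ m i ∧ ∀ j < i, m j = 0) ∨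
          ∃ i, ∀ m ∈ Tset n t, levelKey m = levelKey c ↔ m 0 = i by
        rcases h with ⟨i, h⟩ | ⟨i, h⟩
        · rw [Finset.filter_congr fun a ha => h a (hA ha),
            Finset.filter_congr fun b hb => h b (hB hb)]
          exact hg i
        · rw [Finset.filter_congr fun a ha => h a (hA ha),
            Finset.filter_congr fun b hb => h b (hB hb)]
          exact hh i
      rcases exists_min_index c with rfl | ⟨i, hi, hi'⟩
      · refine Or.inr ⟨0, fun m hm => ?_⟩
        have ht : (0 : ℕ) = t := by simpa [Tset, mdeg] using hc
        have : m = 0 := eq_zero_of_mdeg_eq_zero (hm.trans ht.symm)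
        simp [this]
      · by_cases h0 : i = 0
        · subst h0
          exact Or.inr ⟨c 0, fun m _ => ⟨fun h => (levelKey_eq_iff.1 h).1,
            fun h => (levelKey_eq_of_pos hi h.symm).symm⟩⟩
        · exact Or.inl ⟨i, fun m _ => by rw [eq_comm, levelKey_eq_iff_of_min h0 hi hi']⟩
    · have key : ∀ R : Finset (Mon n), ↑R ⊆ Tset n t → {a ∈ R | levelKey a = v} = ∅ :=
        fun R hR => Finset.filter_eq_empty_iff.2 fun a ha h => hv ⟨a, hR ha, h⟩
      rw [key A hA, key B hB]

lemma lexSegIn_iff {n t : ℕ} {A S : Set (Mon n)} (hA : A ⊆ Tset n t) :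
    LexSegIn t A S ↔ S ⊆ A ∧ ∀ a ∈ S, ∀ b ∈ A, deglexLT a b → b ∈ S := by
  constructor
  · rintro ⟨L, hL, rfl⟩
    exact ⟨Set.inter_subset_right, fun a ha b hb hab => ⟨hL.2 a ha.1 b (hA hb) hab, hb⟩⟩
  · rintro ⟨hSA, hS⟩
    refine ⟨{b | b ∈ Tset n t ∧ ∃ a ∈ S, a = b ∨ deglexLT a b}, ⟨fun b hb => hb.1, ?_⟩, ?_⟩
    · rintro b ⟨-, a, ha, rfl | hab⟩ c hc hbc
      · exact ⟨hc, a, ha, Or.inr hbc⟩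
      · exact ⟨hc, a, ha, Or.inr (hab.trans hbc)⟩
    · ext b
      constructor
      · exact fun hb => ⟨⟨hA (hSA hb), b, hb, Or.inl rfl⟩, hSA hb⟩
      · rintro ⟨⟨-, a, ha, rfl | hab⟩, hb⟩
        · exact ha
        · exact hS a ha b hb hab

lemma ghLex_iff {n t : ℕ} {X : Finset (Mon n)} (hX : ↑X ⊆ Tset n t) :
    GHLex t (X : Set (Mon n)) ↔ KeyLex t X := by
  have hg : ∀ i, growthClass (Tset n t) i ⊆ Tset n t := fun i m hm => hm.1
  have hh : ∀ i, heightClass (Tset n t) i ⊆ Tset n t := fun i m hm => hm.1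
  constructor
  · rintro ⟨h1, h2⟩
    refine ⟨hX, fun a ha b hb hkey hab => ?_⟩
    rcases exists_min_index a with rfl | ⟨i, hi, hi'⟩
    · have ht : (0 : ℕ) = t := by simpa [Tset, mdeg] using hX ha
      rw [eq_zero_of_mdeg_eq_zero (hb.trans ht.symm)] at hab
      exact absurd hab (not_deglexLT_self 0)
    · by_cases h0 : i = 0
      · subst h0
        have hle : a 0 ≤ t :=
          (Finset.single_le_sum (f := a) (fun j _ => Nat.zero_le _) (Finset.mem_univ 0)).trans_eq
            (hX ha)
        exact (((lexSegIn_iff (hh _)).1 (h2 (a 0) hi hle)).2 a ⟨ha, rfl⟩ b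
          ⟨hb, ((levelKey_eq_iff.1 hkey).1).symm⟩ hab).1
      · obtain ⟨hbi, hbi'⟩ := (levelKey_eq_iff_of_min h0 hi hi').1 hkey
        exact (((lexSegIn_iff (hg i)).1 (h1 i)).2 a
          ⟨⟨ha, hi' 0 (Fin.pos_of_ne_zero h0)⟩, hi, hi'⟩ b ⟨hb, hbi, hbi'⟩ hab).1.1
  · rintro ⟨-, h⟩
    refine ⟨fun i => (lexSegIn_iff (hg i)).2 ⟨fun m hm => ⟨hX hm.1.1, hm.2⟩, ?_⟩,
      fun i hi _ => (lexSegIn_iff (hh i)).2 ⟨fun m hm => ⟨hX hm.1, hm.2⟩, ?_⟩⟩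
    · rintro a ⟨⟨ha, ha0⟩, hai, hai'⟩ b ⟨hb, hbi, hbi'⟩ hab
      have h0 : i ≠ 0 := by
        rintro rfl
        omega
      exact ⟨⟨h a ha b hb ((levelKey_eq_iff_of_min h0 hai hai').2 ⟨hbi, hbi'⟩) hab,
        hbi' 0 (Fin.pos_of_ne_zero h0)⟩, hbi, hbi'⟩
    · rintro a ⟨ha, ha0⟩ b ⟨hb, hb0⟩ hab
      exact ⟨h a ha b hb (levelKey_eq_of_pos (by omega) (ha0.trans hb0.symm)) hab, hb0⟩

/-! ## Saturations of Borel ideals -/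

lemma mem_genIdeal_iff {n : ℕ} {B : Set (Mon n)} {m : Mon n} :
    m ∈ genIdeal B ↔ ∃ b ∈ B, ∀ j, b j ≤ m j := by
  constructor
  · rintro ⟨b, hb, c, rfl⟩
    exact ⟨b, hb, fun j => Nat.le_add_right _ _⟩
  · rintro ⟨b, hb, h⟩
    exact ⟨b, hb, m - b, (add_tsub_cancel_of_le (a := b) h).symm⟩

lemma BorelIn.shift_zero_mem {n t : ℕ} {B : Finset (Mon n)} (hB : BorelIn (Tset n t) B)
    {b : Mon n} (hb : b ∈ B) {i : Fin (n + 1)} (hi : i ≠ 0) : shift b 0 i (b 0) ∈ B := by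
  have hC : Tset n t = prefixClass t 0 0 0 := by
    ext m
    simp [Tset, prefixClass]
  rw [hC] at hB
  exact hB.shift_mem (Fin.pos_of_ne_zero hi) hb le_rfl

lemma mem_monSat_genIdeal_iff {n t : ℕ} {B : Finset (Mon n)} (hB : BorelIn (Tset n t) B)
    {m : Mon n} : m ∈ monSat (genIdeal (B : Set (Mon n))) ↔ ∃ b ∈ B, ∀ j ≠ 0, b j ≤ m j := by
  constructor
  · intro h
    obtain ⟨k, hk⟩ := h 0
    obtain ⟨b, hb, hbm⟩ := mem_genIdeal_iff.1 hk
    refine ⟨b, hb, fun j hj => ?_⟩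
    simpa [hj] using hbm j
  · rintro ⟨b, hb, h⟩ i
    refine ⟨b 0, mem_genIdeal_iff.2 ?_⟩
    by_cases hi : i = 0
    · refine ⟨b, hb, fun j => ?_⟩
      by_cases hj : j = 0
      · simp [hi, hj]
      · simpa [hi, hj] using h j hj
    · refine ⟨_, hB.shift_zero_mem hb hi, fun j => ?_⟩
      by_cases hj : j = 0
      · rw [hj, shift_left]
        omega
      · by_cases hji : j = i
        · rw [hji, shift_right _ (Ne.symm hi), if_pos rfl]
          exact Nat.add_le_add_right (h i hi) _
        · rw [shift_of_ne _ hj hji, if_neg hji]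
          exact h j hj

/-- The monomials reached from `b` by changing the exponent of `x_0` and raising the exponent of
the smallest variable of `b` and of the smaller ones. -/
def stanleyCell {n : ℕ} (b : Mon n) : Set (Mon n) :=
  {m | ∀ j ≠ 0, b j ≤ m j ∧ ((∃ l < j, 1 ≤ b l) → m j = b j)}

lemma BorelIn.exists_mem_stanleyCell {n t : ℕ} {B : Finset (Mon n)} (hB : BorelIn (Tset n t) B)
    {m b : Mon n} (hb : b ∈ B) (hbm : ∀ j ≠ 0, b j ≤ m j) : ∃ c ∈ B, m ∈ stanleyCell c := by
  obtain ⟨c, hc, hmax⟩ := exists_deglex_max (S := {c ∈ B | ∀ j ≠ 0, c j ≤ m j})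
    ⟨b, Finset.mem_filter.2 ⟨hb, hbm⟩⟩
  obtain ⟨hcB, hcm⟩ := Finset.mem_filter.1 hc
  refine ⟨c, hcB, fun j hj => ⟨hcm j hj, ?_⟩⟩
  rintro ⟨l, hlj, hl⟩
  by_contra hne
  refine hmax (borelStep c l j) (Finset.mem_filter.2
    ⟨hB.2 c hcB l j hlj hl ((mdeg_borelStep hlj.ne hl).trans (hB.1 hcB)), fun i hi => ?_⟩)
    (deglexLT_borelStep c hlj)
  have h1 := hcm i hi
  by_cases hil : i = l
  · rw [← shift_one, hil, shift_left, ← hil]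
    omega
  · by_cases hij : i = j
    · rw [← shift_one, hij, shift_right _ hlj.ne, ← hij]
      subst hij
      omega
    · rwa [← shift_one, shift_of_ne _ hil hij]

lemma eq_of_mem_stanleyCell {n : ℕ} {a b m : Mon n} (hab : mdeg a = mdeg b)
    (ha : m ∈ stanleyCell a) (hb : m ∈ stanleyCell b) : a = b := by
  have key : ∀ a b : Mon n, mdeg a = mdeg b → m ∈ stanleyCell a → m ∈ stanleyCell b →
      ¬ deglexLT a b := by
    intro a b hab ha hb h
    obtain ⟨k, l, hlk, hk, hl, -⟩ := h.exists_lt hab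
    have hk0 : k ≠ 0 := ((Fin.zero_le l).trans_lt hlk).ne'
    have h1 := (ha k hk0).2 ⟨l, hlk, by omega⟩
    have h2 := (hb k hk0).1
    omega
  rcases deglexLT_trichotomy a b with h | h | h
  · exact absurd h (key a b hab ha hb)
  · exact h
  · exact absurd h (key b a hab.symm hb ha)

lemma mem_monSat_genIdeal_iff_stanleyCell {n t : ℕ} {B : Finset (Mon n)}
    (hB : BorelIn (Tset n t) B) {m : Mon n} :
    m ∈ monSat (genIdeal (B : Set (Mon n))) ↔ ∃ b ∈ B, m ∈ stanleyCell b := by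
  rw [mem_monSat_genIdeal_iff hB]
  exact ⟨fun ⟨b, hb, h⟩ => hB.exists_mem_stanleyCell hb h,
    fun ⟨b, hb, h⟩ => ⟨b, hb, fun j hj => (h j hj).1⟩⟩

lemma card_stanleyCell_le {n s : ℕ} {a b : Mon n} (hdeg : mdeg a = mdeg b)
    (hkey : levelKey a = levelKey b) :
    {m ∈ termFinset n s | m ∈ stanleyCell a}.card ≤
      {m ∈ termFinset n s | m ∈ stanleyCell b}.card := by
  obtain ⟨h0, hmin⟩ := levelKey_eq_iff.1 hkey
  set φ : Mon n → Mon n := fun m j => if j = 0 then m 0 else m j - a j + b j with hφ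
  have hφ0 : ∀ m : Mon n, φ m 0 = m 0 := fun m => if_pos rfl
  have hφj : ∀ (m : Mon n) (j), j ≠ 0 → φ m j = m j - a j + b j := fun m j hj => if_neg hj
  refine Finset.card_le_card_of_injOn φ (fun m hm => ?_) (fun m hm m' hm' h => ?_)
  · obtain ⟨hm, hma⟩ := Finset.mem_filter.1 hm
    refine Finset.mem_filter.2 ⟨mem_termFinset.2 ?_, fun j hj => ?_⟩
    · have hsum : φ m + a = m + b := by
        funext j
        by_cases hj : j = 0
        · subst hj
          simp [hφ0, h0]
        · have := (hma j hj).1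
          rw [Pi.add_apply, Pi.add_apply, hφj m j hj]
          omega
      have hmdeg : mdeg (φ m + a) = mdeg (m + b) := by rw [hsum]
      have hadd : ∀ u v : Mon n, mdeg (u + v) = mdeg u + mdeg v := fun u v => by
        simp [mdeg, Finset.sum_add_distrib]
      rw [hadd, hadd, mem_termFinset.1 hm] at hmdeg
      omega
    · have h1 := hma j hj
      rw [hφj m j hj]
      refine ⟨Nat.le_add_left _ _, ?_⟩
      rintro ⟨l, hl, hbl⟩
      obtain ⟨l', hl', hal'⟩ := (hmin l).2 ⟨l, le_rfl, hbl⟩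
      rw [h1.2 ⟨l', hl'.trans_lt hl, hal'⟩]
      omega
  · funext j
    have h1 := congrFun h j
    by_cases hj : j = 0
    · subst hj
      rwa [hφ0, hφ0] at h1
    · have h2 := ((Finset.mem_filter.1 hm).2 j hj).1
      have h3 := ((Finset.mem_filter.1 hm').2 j hj).1
      rw [hφj m j hj, hφj m' j hj] at h1
      omega

lemma card_filter_mem_monSat {n t : ℕ} {B : Finset (Mon n)} (hB : BorelIn (Tset n t) B) (s : ℕ) :
    {m ∈ termFinset n s | m ∈ monSat (genIdeal (B : Set (Mon n)))}.card =
      ∑ b ∈ B, {m ∈ termFinset n s | m ∈ stanleyCell b}.card := by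
  rw [← Finset.card_biUnion]
  · congr 1
    ext m
    simp only [Finset.mem_filter, Finset.mem_biUnion, mem_monSat_genIdeal_iff_stanleyCell hB]
    exact ⟨fun ⟨h1, b, hb, h2⟩ => ⟨b, hb, h1, h2⟩, fun ⟨b, hb, h1, h2⟩ => ⟨h1, b, hb, h2⟩⟩
  · refine fun a ha b hb hab => Finset.disjoint_left.2 fun m hm hm' => hab ?_
    exact eq_of_mem_stanleyCell ((hB.1 ha).trans (hB.1 hb).symm) (Finset.mem_filter.1 hm).2
      (Finset.mem_filter.1 hm').2

lemma hilb_add_card {n : ℕ} (J : Set (Mon n)) (s : ℕ) :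
    {m ∈ termFinset n s | m ∈ J}.card + hilb J s = (termFinset n s).card := by
  have : {m : Mon n | mdeg m = s ∧ m ∉ J} = ↑{m ∈ termFinset n s | m ∉ J} := by
    ext m
    simp [mem_termFinset]
  rw [hilb, this, Set.ncard_coe_finset]
  exact Finset.card_filter_add_card_filter_not _

/-- The Hilbert function of the saturation of a Borel ideal only depends on the sizes of the joint
growth and height classes. -/
theorem SameKeys.hilb_eq {n t : ℕ} {A B : Finset (Mon n)} (h : SameKeys A B)
    (hA : BorelIn (Tset n t) A) (hB : BorelIn (Tset n t) B) (s : ℕ) :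
    hilb (monSat (genIdeal (A : Set (Mon n)))) s =
      hilb (monSat (genIdeal (B : Set (Mon n)))) s := by
  have h1 := hilb_add_card (monSat (genIdeal (A : Set (Mon n)))) s
  have h2 := hilb_add_card (monSat (genIdeal (B : Set (Mon n)))) s
  rw [card_filter_mem_monSat hA] at h1
  rw [card_filter_mem_monSat hB] at h2
  have h3 := h.sum_eq hA.1 hB.1 (F := fun b => {m ∈ termFinset n s | m ∈ stanleyCell b}.card)
    fun a ha b hb hab => by
      have hdeg : mdeg a = mdeg b := Eq.trans ha hb.symm
      exact (card_stanleyCell_le hdeg hab).antisymm (card_stanleyCell_le hdeg.symm hab.symm)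
  omega

/-! ## Regularity -/

lemma mdeg_eq_add_sum {n : ℕ} (m : Mon n) : mdeg m = m 0 + ∑ i : Fin n, m i.succ :=
  Fin.sum_univ_succ m

lemma eq_of_mdeg_eq_of_forall_ne_zero {n : ℕ} {a b : Mon n} (hdeg : mdeg a = mdeg b)
    (h : ∀ j ≠ 0, a j = b j) : a = b := by
  rw [mdeg_eq_add_sum, mdeg_eq_add_sum,
    Finset.sum_congr rfl fun i _ => h _ (Fin.succ_ne_zero i)] at hdeg
  funext j
  by_cases hj : j = 0
  · rw [hj]
    omega
  · exact h j hj

lemma mdeg_update_zero {n : ℕ} (m : Mon n) : mdeg (Function.update m 0 0) + m 0 = mdeg m := by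
  rw [mdeg_eq_add_sum, mdeg_eq_add_sum m, Function.update_self,
    Finset.sum_congr rfl fun i _ => Function.update_of_ne (Fin.succ_ne_zero i) _ _]
  omega

lemma BorelIn.mem_of_le {n t : ℕ} {B : Finset (Mon n)} (hB : BorelIn (Tset n t) B)
    {b m : Mon n} (hb : b ∈ B) (hm : mdeg m = t) (h : ∀ j ≠ 0, b j ≤ m j) : m ∈ B := by
  obtain ⟨c, hc, hcm⟩ := hB.exists_mem_stanleyCell hb h
  have hct : mdeg c = t := hB.1 hc
  suffices heq : c = m by rwa [← heq]
  refine eq_of_mdeg_eq_of_forall_ne_zero (hct.trans hm.symm) fun j hj => ?_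
  by_cases h0 : 1 ≤ c 0
  · exact ((hcm j hj).2 ⟨0, Fin.pos_of_ne_zero hj, h0⟩).symm
  · have hle : ∀ i ∈ Finset.univ, c i ≤ m i := fun i _ => by
      by_cases hi : i = 0
      · rw [hi]
        omega
      · exact (hcm i hi).1
    exact (Finset.sum_eq_sum_iff_of_le hle).1 (hct.trans hm.symm) j (Finset.mem_univ j)

lemma isMinGen_monSat_iff {n t : ℕ} {B : Finset (Mon n)} (hB : BorelIn (Tset n t) B)
    {m : Mon n} : IsMinGen (monSat (genIdeal (B : Set (Mon n)))) m ↔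
      ∃ u ∈ B, m = Function.update u 0 0 ∧
        ∀ b ∈ B, 1 ≤ b 0 → ∀ j ≠ 0, borelStep b 0 j ≠ u := by
  have hsat := fun m => mem_monSat_genIdeal_iff hB (m := m)
  constructor
  · rintro ⟨hm, hmin⟩
    obtain ⟨u, hu, hum⟩ := (hsat m).1 hm
    have hne : ∀ b ∈ B, ∀ j ≠ 0, (∀ i ≠ 0, b i ≤ m i) → ¬ b j < m j := by
      intro b hb j hj hbm hlt
      refine hmin j (by omega) ((hsat _).2 ⟨b, hb, fun i hi => ?_⟩)
      unfold shrinkAt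
      split_ifs with hij
      · subst hij
        omega
      · exact hbm i hi
    have humj : ∀ j ≠ 0, m j = u j := fun j hj =>
      (not_lt.1 (hne u hu j hj hum)).antisymm (hum j hj)
    refine ⟨u, hu, ?_, ?_⟩
    · funext j
      by_cases hj : j = 0
      · subst hj
        rw [Function.update_self]
        by_contra h0
        refine hmin 0 (Nat.one_le_iff_ne_zero.2 h0) ((hsat _).2 ⟨u, hu, fun i hi => ?_⟩)
        simpa [shrinkAt, hi] using hum i hi
      · rw [Function.update_of_ne hj, humj j hj]
    · rintro b hb - j hj rfl
      have hbj : m j = b j + 1 := by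
        rw [humj j hj, ← shift_one, shift_right _ (Ne.symm hj)]
      refine hne b hb j hj (fun i hi => ?_) (by omega)
      by_cases hij : i = j
      · rw [hij]
        omega
      · rw [humj i hi, ← shift_one, shift_of_ne _ hi hij]
  · rintro ⟨u, hu, rfl, hgap⟩
    refine ⟨(hsat _).2 ⟨u, hu, fun j hj => by rw [Function.update_of_ne hj]⟩, fun i hi hmem => ?_⟩
    have hi0 : i ≠ 0 := by
      rintro rfl
      simp at hi
    rw [Function.update_of_ne hi0] at hi
    obtain ⟨c, hc, hcm⟩ := (hsat _).1 hmem
    have hmemB : borelStep u i 0 ∈ B := by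
      refine hB.mem_of_le hc ((mdeg_borelStep hi0 hi).trans (hB.1 hu)) fun j hj => ?_
      simpa [shrinkAt, borelStep, hj] using hcm j hj
    refine hgap _ hmemB ?_ i hi0 (shift_shift hi0 hi)
    rw [← shift_one, shift_right _ hi0]
    omega

lemma mdeg_le_of_isMinGen {n t : ℕ} {B : Finset (Mon n)} (hB : BorelIn (Tset n t) B)
    {m : Mon n} (hm : IsMinGen (monSat (genIdeal (B : Set (Mon n)))) m) : mdeg m ≤ t := by
  obtain ⟨u, hu, rfl, -⟩ := (isMinGen_monSat_iff hB).1 hm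
  have h1 := mdeg_update_zero u
  have h2 : mdeg u = t := hB.1 hu
  omega

lemma monReg_le {n t : ℕ} {B : Finset (Mon n)} (hB : BorelIn (Tset n t) B) :
    monReg (monSat (genIdeal (B : Set (Mon n)))) ≤ t :=
  csSup_le' fun _ ⟨_, hm, hd⟩ => hd ▸ mdeg_le_of_isMinGen hB hm

/-- The terms obtained from terms of `B` divisible by exactly `x_0^(k+1)` by replacing one `x_0`. -/
def heightShadow {n : ℕ} (B : Finset (Mon n)) (k : ℕ) : Finset (Mon n) :=
  (Finset.univ.filter fun j : Fin (n + 1) => j ≠ 0).biUnion fun j =>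
    {b ∈ B | b 0 = k + 1}.image fun b => borelStep b 0 j

lemma mem_heightShadow {n k : ℕ} {B : Finset (Mon n)} {u : Mon n} :
    u ∈ heightShadow B k ↔ ∃ j ≠ 0, ∃ b ∈ B, b 0 = k + 1 ∧ borelStep b 0 j = u := by
  simp [heightShadow, and_assoc]

lemma BorelIn.heightShadow_subset {n t k : ℕ} {B : Finset (Mon n)} (hB : BorelIn (Tset n t) B) :
    heightShadow B k ⊆ {b ∈ B | b 0 = k} := by
  intro u hu
  obtain ⟨j, hj, b, hb, hb0, rfl⟩ := mem_heightShadow.1 hu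
  have hb1 : 1 ≤ b 0 := by omega
  refine Finset.mem_filter.2 ⟨hB.2 b hb 0 j (Fin.pos_of_ne_zero hj) hb1
    ((mdeg_borelStep (Ne.symm hj) hb1).trans (hB.1 hb)), ?_⟩
  rw [← shift_one, shift_left]
  omega

/-- Degree-`t` monomials divisible by exactly `x_0^k` and by none of `x_1, ..., x_{j-1}`. -/
abbrev heightPrefixClass (n t k : ℕ) (j : Fin (n + 1)) : Set (Mon n) :=
  prefixClass t (Function.update 0 0 k) j 0

lemma mem_heightPrefixClass {n t k : ℕ} {j : Fin (n + 1)} (hj : j ≠ 0) {m : Mon n} :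
    m ∈ heightPrefixClass n t k j ↔ mdeg m = t ∧ m 0 = k ∧ ∀ l < j, l ≠ 0 → m l = 0 := by
  constructor
  · rintro ⟨h1, h2, -⟩
    refine ⟨h1, by simpa using h2 0 (Fin.pos_of_ne_zero hj), fun l hl hl0 => ?_⟩
    simpa [hl0] using h2 l hl
  · rintro ⟨h1, h2, h3⟩
    refine ⟨h1, fun l hl => ?_, Nat.zero_le _⟩
    by_cases hl0 : l = 0
    · simp [hl0, h2]
    · simp [hl0, h3 l hl hl0]

lemma BorelIn.card_heightShadow {n t : ℕ} {B : Finset (Mon n)} (hB : BorelIn (Tset n t) B)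
    (k : ℕ) : (heightShadow B k).card =
      ∑ j : Fin (n + 1) with j ≠ 0, {b ∈ B | b ∈ heightPrefixClass n t (k + 1) j}.card := by
  have hunion : heightShadow B k = (Finset.univ.filter fun j : Fin (n + 1) => j ≠ 0).biUnion
      fun j => {b ∈ B | b ∈ heightPrefixClass n t (k + 1) j}.image fun b => borelStep b 0 j := by
    ext u
    rw [mem_heightShadow, Finset.mem_biUnion]
    constructor
    · rintro ⟨j, hj, b, hb, hb0, rfl⟩
      obtain ⟨i, hi, hmin⟩ := WellFounded.has_min (wellFounded_lt (α := Fin (n + 1)))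
        {i | i ≠ 0 ∧ 1 ≤ borelStep b 0 j i} ⟨j, hj, by
          rw [← shift_one, shift_right _ (Ne.symm hj)]
          omega⟩
      have hb1 : 1 ≤ b 0 := by omega
      have hmin' : ∀ l < i, l ≠ 0 → borelStep b 0 j l = 0 := fun l hl hl0 => by
        by_contra hne
        exact hmin l ⟨hl0, Nat.one_le_iff_ne_zero.2 hne⟩ hl
      have hij : i ≤ j := by
        by_contra! hji
        have := hmin' j hji hj
        rw [← shift_one, shift_right _ (Ne.symm hj)] at this
        omega
      have hdeg : mdeg (borelStep b 0 j) = t := (mdeg_borelStep (Ne.symm hj) hb1).trans (hB.1 hb)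
      have hmem : borelStep (borelStep b 0 j) i 0 ∈ B := by
        rcases hij.lt_or_eq with hlt | rfl
        · have hbi : 1 ≤ b i := by
            have := hi.2
            rwa [← shift_one, shift_of_ne _ hi.1 hlt.ne] at this
          have heq : borelStep (borelStep b 0 j) i 0 = borelStep b i j := by
            funext l
            have h0 : (0 : Fin (n + 1)) ≠ i := Ne.symm hi.1
            by_cases hl0 : l = 0
            · subst hl0
              simp only [borelStep, if_neg h0, if_neg (Ne.symm hj), if_true]
              omega
            · by_cases hli : l = i
              · simp [borelStep, hi.1, hli, hlt.ne]
              · simp [borelStep, hl0, hli]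
          rw [heq]
          exact hB.2 b hb i j hlt hbi ((mdeg_borelStep hlt.ne hbi).trans (hB.1 hb))
        · have heq : borelStep (borelStep b 0 i) i 0 = b := shift_shift (Ne.symm hj) hb1
          rwa [heq]
      refine ⟨i, by simpa using hi.1, Finset.mem_image.2
        ⟨_, Finset.mem_filter.2 ⟨hmem, (mem_heightPrefixClass hi.1).2 ⟨hB.1 hmem, ?_, ?_⟩⟩,
          shift_shift hi.1 hi.2⟩⟩
      · rw [← shift_one, shift_right _ hi.1, ← shift_one, shift_left]
        omega
      · intro l hl hl0
        rw [← shift_one (borelStep b 0 j), shift_of_ne _ hl.ne hl0]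
        exact hmin' l hl hl0
    · rintro ⟨j, hj, hu⟩
      have hj : j ≠ 0 := by simpa using hj
      obtain ⟨b, hb, rfl⟩ := Finset.mem_image.1 hu
      obtain ⟨hb, hbC⟩ := Finset.mem_filter.1 hb
      exact ⟨j, hj, b, hb, ((mem_heightPrefixClass hj).1 hbC).2.1, rfl⟩
  rw [hunion, Finset.card_biUnion]
  · refine Finset.sum_congr rfl fun j hj => Finset.card_image_of_injOn ?_
    have hj : j ≠ 0 := by simpa using hj
    refine (shift_injOn 0 j 1 (Ne.symm hj)).mono fun b hb => ?_
    have := ((mem_heightPrefixClass hj).1 (Finset.mem_filter.1 hb).2).2.1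
    show 1 ≤ b 0
    omega
  · have key : ∀ i j : Fin (n + 1), i ≠ 0 → j ≠ 0 → i < j → ∀ a b : Mon n,
        b ∈ heightPrefixClass n t (k + 1) j → borelStep a 0 i ≠ borelStep b 0 j := by
      intro i j hi hj hij a b hb h
      have h1 := congrFun h i
      rw [← shift_one, ← shift_one, shift_right _ (Ne.symm hi), shift_of_ne _ hi hij.ne,
        ((mem_heightPrefixClass hj).1 hb).2.2 i hij hi] at h1
      omega
    intro i hi j hj hij
    have hi : i ≠ 0 := by simpa using hi
    have hj : j ≠ 0 := by simpa using hj
    refine Finset.disjoint_left.2 fun u hu hu' => ?_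
    obtain ⟨a, ha, rfl⟩ := Finset.mem_image.1 hu
    obtain ⟨b, hb, hab⟩ := Finset.mem_image.1 hu'
    rcases hij.lt_or_gt with h | h
    · exact key i j hi hj h a b (Finset.mem_filter.1 hb).2 hab.symm
    · exact key j i hj hi h b a (Finset.mem_filter.1 ha).2 hab

lemma card_filter_not_le_of_upperIn_of_borelIn {n t : ℕ} {p : Fin (n + 1)} {c : ℕ} {f : Mon n}
    {A U : Finset (Mon n)} (hA : BorelIn (prefixClass t f p c) A)
    (hU : UpperIn (prefixClass t f p c) U) (h : U.card ≤ A.card) (s : ℕ) :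
    {u ∈ U | ¬ s ≤ u p}.card ≤ {u ∈ A | ¬ s ≤ u p}.card := by
  have hC : (({m ∈ termFinset n t | m ∈ prefixClass t f p c} : Finset (Mon n)) : Set (Mon n)) =
      prefixClass t f p c := by
    ext m
    simp only [Finset.coe_filter, mem_termFinset, Set.mem_ofPred_eq, and_iff_right_iff_imp]
    exact fun hm => hm.1
  obtain ⟨V, hV, hVA⟩ := exists_upperIn_card_eq {m ∈ termFinset n t | m ∈ prefixClass t f p c}
    (Finset.card_le_card (s := A) fun a ha => by
      rw [← Finset.mem_coe, hC]
      exact hA.1 ha)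
  rw [hC] at hV
  have hUV : U ⊆ V := hU.subset_of_card_le hV (h.trans hVA.ge)
  have h1 := card_filter_le_of_borelIn_of_upperIn p c f A V hA hV hVA.ge s
  have h2 := Finset.card_filter_add_card_filter_not (s := A) (fun u : Mon n => s ≤ u p)
  have h3 := Finset.card_filter_add_card_filter_not (s := V) (fun u : Mon n => s ≤ u p)
  have h4 := Finset.card_le_card (Finset.filter_subset_filter (fun u : Mon n => ¬ s ≤ u p) hUV)
  omega

lemma KeyLex.card_heightPrefixClass_le {n t : ℕ} {B L : Finset (Mon n)}
    (hB : BorelIn (Tset n t) B) (hL : KeyLex t L) (hBL : SameKeys B L) (k : ℕ)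
    {j : Fin (n + 1)} (hj : j ≠ 0) :
    UpperIn (heightPrefixClass n t (k + 1) j) {u ∈ L | u ∈ heightPrefixClass n t (k + 1) j} ∧
    {u ∈ L | u ∈ heightPrefixClass n t (k + 1) j}.card ≤
      {u ∈ B | u ∈ heightPrefixClass n t (k + 1) j}.card := by
  induction j using Fin.induction with
  | zero => exact absurd rfl hj
  | succ i ih =>
    by_cases hi : i.castSucc = 0
    · have hC : IsKeyClass t (heightPrefixClass n t (k + 1) i.succ) := by
        have := isKeyClass_prefixClass_height t hi k
        rwa [hi] at this
      exact ⟨hL.upperIn hC, (hBL.card_eq hB.1 hL.1 hC).ge⟩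
    · obtain ⟨h1, h2⟩ := ih hi
      have hsub : heightPrefixClass n t (k + 1) i.castSucc ⊆ Tset n t := fun m hm => hm.1
      have hiff : ∀ m, m ∈ heightPrefixClass n t (k + 1) i.succ ↔
          m ∈ heightPrefixClass n t (k + 1) i.castSucc ∧ ¬ 1 ≤ m i.castSucc := by
        intro m
        rw [mem_heightPrefixClass hj, mem_heightPrefixClass hi]
        constructor
        · rintro ⟨h1, h2, h3⟩
          refine ⟨⟨h1, h2, fun l hl => h3 l (hl.trans Fin.castSucc_lt_succ)⟩, ?_⟩
          rw [h3 _ Fin.castSucc_lt_succ hi]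
          omega
        · rintro ⟨⟨h1, h2, h3⟩, h4⟩
          refine ⟨h1, h2, fun l hl hl0 => ?_⟩
          rcases (Fin.le_castSucc_iff.2 hl).lt_or_eq with hl | rfl
          · exact h3 l hl hl0
          · omega
      have hfilter : ∀ R : Finset (Mon n),
          {u ∈ R | u ∈ heightPrefixClass n t (k + 1) i.succ} =
          {u ∈ {u ∈ R | u ∈ heightPrefixClass n t (k + 1) i.castSucc} | ¬ 1 ≤ u i.castSucc} := by
        intro R
        rw [Finset.filter_filter]
        exact Finset.filter_congr fun u _ => hiff u
      rw [hfilter B, hfilter L]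
      exact ⟨h1.filter (fun m hm => ((hiff m).1 hm).1)
        fun m hm => ⟨fun h => (hiff m).2 ⟨hm, h⟩, fun h => ((hiff m).1 h).2⟩,
        card_filter_not_le_of_upperIn_of_borelIn (hB.filter hsub fun _ _ => Iff.rfl) h1 h2 1⟩

theorem KeyLex.monReg_le_monReg {n t : ℕ} {B L : Finset (Mon n)} (hB : BorelIn (Tset n t) B)
    (hL : KeyLex t L) (hBL : SameKeys B L) :
    monReg (monSat (genIdeal (B : Set (Mon n)))) ≤
      monReg (monSat (genIdeal (L : Set (Mon n)))) := by
  have hLB := hL.borelIn hB hBL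
  refine csSup_le' ?_
  rintro _ ⟨m, hm, rfl⟩
  obtain ⟨u, hu, rfl, hgap⟩ := (isMinGen_monSat_iff hB).1 hm
  have hlt : (heightShadow B (u 0)).card < {b ∈ B | b 0 = u 0}.card := by
    refine Finset.card_lt_card ⟨hB.heightShadow_subset, fun h => ?_⟩
    obtain ⟨j, hj, b, hb, hb0, hbu⟩ := mem_heightShadow.1 (h (Finset.mem_filter.2 ⟨hu, rfl⟩))
    exact hgap b hb (by omega) j hj hbu
  have hle : (heightShadow L (u 0)).card ≤ (heightShadow B (u 0)).card := by
    rw [hB.card_heightShadow, hLB.card_heightShadow]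
    exact Finset.sum_le_sum fun j hj =>
      (hL.card_heightPrefixClass_le hB hBL (u 0) (Finset.mem_filter.1 hj).2).2
  have heq : {b ∈ B | b 0 = u 0}.card = {b ∈ L | b 0 = u 0}.card :=
    hBL.card_filter_eq hB.1 hL.1 fun a b hab => by rw [(levelKey_eq_iff.1 hab).1]
  obtain ⟨v, hv, hvL⟩ := Finset.exists_mem_notMem_of_card_lt_card (hle.trans_lt (hlt.trans_eq heq))
  obtain ⟨hv, hv0⟩ := Finset.mem_filter.1 hv
  have hdeg : mdeg (Function.update u 0 0) = mdeg (Function.update v 0 0) := by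
    have h1 := mdeg_update_zero u
    have h2 := mdeg_update_zero v
    have h3 : mdeg u = t := hB.1 hu
    have h4 : mdeg v = t := hL.1 hv
    omega
  refine le_csSup ⟨t, fun _ ⟨_, hm, hd⟩ => hd ▸ mdeg_le_of_isMinGen hLB hm⟩
    ⟨_, (isMinGen_monSat_iff hLB).2 ⟨v, hv, rfl, fun b hb hb0 j hj hbv => hvL ?_⟩, hdeg.symm⟩
  refine mem_heightShadow.2 ⟨j, hj, b, hb, ?_, hbv⟩
  rw [← hv0, ← hbv, ← shift_one, shift_left]
  omega

/-- Theorem `th:crucial`.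
Let `B ⊆ T_t` be a Borel set. Then there is a unique growth-height-lexicographic Borel set
`L_gh(B) ⊆ T_t` with the same growth vector and height vector as `B`. Moreover, the
saturated ideals `J = (B)^sat` and `I = (L_gh(B))^sat` have the same Hilbert function and
`reg(J) ≤ reg(I) ≤ t`. -/
theorem statement10 {n : ℕ} (t : ℕ) (B : Set (Mon n)) (hB : IsBorelSet t B) :
    ∃ L : Set (Mon n),
      (IsBorelSet t L ∧ GHLex t L ∧
        (∀ i : Fin (n + 1), (growthClass L i).ncard = (growthClass B i).ncard) ∧
        (∀ i : ℕ, (heightClass L i).ncard = (heightClass B i).ncard)) ∧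
      (∀ L' : Set (Mon n),
        (IsBorelSet t L' ∧ GHLex t L' ∧
          (∀ i : Fin (n + 1), (growthClass L' i).ncard = (growthClass B i).ncard) ∧
          (∀ i : ℕ, (heightClass L' i).ncard = (heightClass B i).ncard)) → L' = L) ∧
      (∀ s : ℕ, hilb (monSat (genIdeal B)) s = hilb (monSat (genIdeal L)) s) ∧
      monReg (monSat (genIdeal B)) ≤ monReg (monSat (genIdeal L)) ∧
      monReg (monSat (genIdeal L)) ≤ t := by
  have hfin : ∀ X : Set (Mon n), IsBorelSet t X → ∃ A : Finset (Mon n), ↑A = X := fun X hX =>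
    ((termFinset n t).finite_toSet.subset fun m hm => mem_termFinset.2 (hX.1 hm)).exists_finset_coe
  obtain ⟨B, rfl⟩ := hfin B hB
  rw [isBorelSet_coe_iff] at hB
  obtain ⟨L, hL, hBL⟩ := exists_keyLex hB.1
  have hLB := hL.borelIn hB hBL
  have hLB' : SameKeys L B := fun v => (hBL v).symm
  refine ⟨L, ⟨isBorelSet_coe_iff.2 hLB, (ghLex_iff hL.1).2 hL, (sameKeys_iff hL.1 hB.1).1 hLB'⟩,
    ?_, hBL.hilb_eq hB hLB, hL.monReg_le_monReg hB hBL, monReg_le hLB⟩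
  rintro L' ⟨hL', hgh, hvec⟩
  obtain ⟨L', rfl⟩ := hfin L' hL'
  have hsame := (sameKeys_iff hL'.1 hB.1).2 hvec
  rw [((ghLex_iff hL'.1).1 hgh).eq_of_sameKeys hL fun v => (hsame v).trans (hBL v)]
end
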